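/- arXiv:1303.5155 — 2 statements merged into one kernel-verified Lean document; each statement's English description precedes it below -/
import Mathlib

section
/- Let P be a finite poset which is an extension of a subposet Q. Then there is a long exact Mayer–Vietoris sequence in reduced simplicial homology over the integers: ... -> H~_n(Q) -> H~_n(P) -> H~_n(P_Q) -> H~_{n-1}(Q) -> ..., where the first two maps are induced by the inclusions Q into P and P into P_Q, and the connecting map r is given as follows: if alpha is an augmented n-chain of P and beta an augmented n-chain of Q_Q with boundary(alpha + beta) = 0 in P_Q, then r([alpha + beta]) = [boundary(alpha)]. Moreover, if P is a G-poset for a group G and Q is stable under the action of G, then this is a long exact sequence of ZG-modules. -/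
/-! Ordered chains, the augmented simplicial chain complex of the order complex of a poset
(given by an arbitrary strict-order relation), reduced homology, and induced maps. -/

/-- Ordered chains with `n` vertices with respect to a relation `r`
(the `(n-1)`-simplices of the order complex). -/
def OCh (α : Type*) (r : α → α → Prop) (n : ℕ) : Type _ :=
  {f : Fin n → α // ∀ ⦃i j : Fin n⦄, i < j → r (f i) (f j)}

/-- The augmented simplicial chain group with `n`-vertex chains as basis
(`n = 0` gives the augmentation degree `-1`). -/
abbrev ACh (α : Type*) (r : α → α → Prop) (n : ℕ) := OCh α r n →₀ ℤ

/-- The `i`-th face of an `(n+1)`-vertex ordered chain. -/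
def OCh.face {α : Type*} {r : α → α → Prop} {n : ℕ} (c : OCh α r (n + 1)) (i : Fin (n + 1)) :
    OCh α r n :=
  ⟨c.1 ∘ i.succAbove, fun _ _ h => c.2 (Fin.strictMono_succAbove i h)⟩

/-- The simplicial boundary map of the augmented chain complex. -/
noncomputable def bdry (α : Type*) (r : α → α → Prop) (n : ℕ) :
    ACh α r (n + 1) →ₗ[ℤ] ACh α r n :=
  Finsupp.lsum ℤ fun c => LinearMap.toSpanSingleton ℤ _
    (∑ i : Fin (n + 1), ((-1 : ℤ) ^ (i : ℕ)) • Finsupp.single (c.face i) (1 : ℤ))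

/-- Augmented `n`-cycles (chains with `n+1` vertices). -/
noncomputable def cyc (α : Type*) (r : α → α → Prop) (n : ℕ) :
    Submodule ℤ (ACh α r (n + 1)) := LinearMap.ker (bdry α r n)

/-- Augmented `n`-boundaries (chains with `n+1` vertices). -/
noncomputable def bdries (α : Type*) (r : α → α → Prop) (n : ℕ) :
    Submodule ℤ (ACh α r (n + 1)) := LinearMap.range (bdry α r (n + 1))

/-- Reduced simplicial homology `H̃ₙ` (over `ℤ`) of the order complex of `(α, r)`. -/
noncomputable abbrev redH (α : Type*) (r : α → α → Prop) (n : ℕ) :=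
  cyc α r n ⧸ (bdries α r n).comap (cyc α r n).subtype

/-- Reduced homology in degree `-1`. -/
noncomputable abbrev redHneg (α : Type*) (r : α → α → Prop) :=
  (⊤ : Submodule ℤ (ACh α r 0)) ⧸
    (LinearMap.range (bdry α r 0)).comap (⊤ : Submodule ℤ (ACh α r 0)).subtype

section maps

variable {α β : Type*} {rα : α → α → Prop} {rβ : β → β → Prop}

/-- The simplicial map on ordered chains induced by a relation-preserving map. -/
def cmap (f : α → β) (hf : ∀ ⦃a b⦄, rα a b → rβ (f a) (f b)) {n : ℕ} (c : OCh α rα n) :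
    OCh β rβ n :=
  ⟨f ∘ c.1, fun _ _ h => hf (c.2 h)⟩

/-- The induced map on augmented chain groups. -/
noncomputable def cmapL (f : α → β) (hf : ∀ ⦃a b⦄, rα a b → rβ (f a) (f b)) (n : ℕ) :
    ACh α rα n →ₗ[ℤ] ACh β rβ n :=
  Finsupp.lmapDomain ℤ ℤ (cmap f hf)

theorem bdry_single {n : ℕ} (c : OCh α rα (n + 1)) (b : ℤ) :
    bdry α rα n (Finsupp.single c b) =
      b • ∑ i : Fin (n + 1), ((-1 : ℤ) ^ (i : ℕ)) • Finsupp.single (c.face i) (1 : ℤ) := by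
  simp [bdry, Finsupp.lsum_single, LinearMap.toSpanSingleton_apply]

theorem face_cmap (f : α → β) (hf : ∀ ⦃a b⦄, rα a b → rβ (f a) (f b)) {n : ℕ}
    (c : OCh α rα (n + 1)) (i : Fin (n + 1)) :
    (cmap f hf c).face i = cmap f hf (c.face i) := rfl

/-- Naturality of the boundary map. -/
theorem bdry_cmapL (f : α → β) (hf : ∀ ⦃a b⦄, rα a b → rβ (f a) (f b)) (n : ℕ) :
    (bdry β rβ n).comp (cmapL f hf (n + 1)) = (cmapL f hf n).comp (bdry α rα n) := by
  refine Finsupp.lhom_ext fun c b => ?_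
  simp only [LinearMap.comp_apply, cmapL, Finsupp.lmapDomain_apply, Finsupp.mapDomain_single,
    bdry_single]
  rw [← Finsupp.lmapDomain_apply ℤ ℤ (cmap f hf), map_smul, map_sum]
  simp [Finsupp.lmapDomain_apply, Finsupp.mapDomain_single, face_cmap]

theorem cmapL_mem_cyc (f : α → β) (hf : ∀ ⦃a b⦄, rα a b → rβ (f a) (f b)) {n : ℕ}
    {z : ACh α rα (n + 1)} (hz : z ∈ cyc α rα n) :
    cmapL f hf (n + 1) z ∈ cyc β rβ n := by
  have := congrArg (fun φ : ACh α rα (n+1) →ₗ[ℤ] ACh β rβ n => φ z) (bdry_cmapL f hf n)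
  simp only [LinearMap.comp_apply] at this
  simp only [cyc, LinearMap.mem_ker] at hz ⊢
  rw [this, hz, map_zero]

/-- The induced map on reduced homology of a relation-preserving map. -/
noncomputable def indH (f : α → β) (hf : ∀ ⦃a b⦄, rα a b → rβ (f a) (f b)) (n : ℕ) :
    redH α rα n →ₗ[ℤ] redH β rβ n :=
  Submodule.mapQ _ _
    ((cmapL f hf (n + 1)).restrict (fun _ hz => cmapL_mem_cyc f hf hz))
    (by
      rintro ⟨z, hz⟩ hmem
      simp only [Submodule.mem_comap, bdries, LinearMap.mem_range] at hmem ⊢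
      obtain ⟨w, hw⟩ := hmem
      refine ⟨cmapL f hf (n + 2) w, ?_⟩
      have := congrArg (fun φ : ACh α rα (n+2) →ₗ[ℤ] ACh β rβ (n+1) => φ w) (bdry_cmapL f hf (n+1))
      simp only [LinearMap.comp_apply] at this
      simp only [LinearMap.restrict_apply]
      rw [this, hw]
      rfl)

/-- The induced map on reduced homology in degree `-1`. -/
noncomputable def indHneg (f : α → β) (hf : ∀ ⦃a b⦄, rα a b → rβ (f a) (f b)) :
    redHneg α rα →ₗ[ℤ] redHneg β rβ :=
  Submodule.mapQ _ _ ((cmapL f hf 0).restrict (fun _ _ => Submodule.mem_top))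
    (by
      rintro ⟨z, hz⟩ hmem
      simp only [Submodule.mem_comap, LinearMap.mem_range] at hmem ⊢
      obtain ⟨w, hw⟩ := hmem
      refine ⟨cmapL f hf 1 w, ?_⟩
      have := congrArg (fun φ : ACh α rα 1 →ₗ[ℤ] ACh β rβ 0 => φ w) (bdry_cmapL f hf 0)
      simp only [LinearMap.comp_apply] at this
      simp only [LinearMap.restrict_apply]
      rw [this, hw]
      rfl)

/-- Coning off chains with a new bottom vertex `b`. -/
def coneMap (f : α → β) (hf : ∀ ⦃a b⦄, rα a b → rβ (f a) (f b)) (b : β)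
    (hb : ∀ a : α, rβ b (f a)) {n : ℕ} (c : OCh α rα n) : OCh β rβ (n + 1) :=
  ⟨Fin.cons b (f ∘ c.1), by
    intro i j hij
    rcases Fin.eq_zero_or_eq_succ j with hj | ⟨j', rfl⟩
    · subst hj; exact absurd hij (Fin.not_lt_zero i)
    · rcases Fin.eq_zero_or_eq_succ i with hi | ⟨i', rfl⟩
      · subst hi; simpa using hb (c.1 j')
      · have h' : i' < j' := by simpa using hij
        simpa using hf (c.2 h')⟩

/-- The linear extension of `coneMap` to chain groups: `z ↦ b * z`. -/
noncomputable def coneL (f : α → β) (hf : ∀ ⦃a b⦄, rα a b → rβ (f a) (f b)) (b : β)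
    (hb : ∀ a : α, rβ b (f a)) (n : ℕ) : ACh α rα n →ₗ[ℤ] ACh β rβ (n + 1) :=
  Finsupp.lmapDomain ℤ ℤ (coneMap f hf b hb)

end maps

section PosetConstructions

/-- The strict order of the poset `P_Q` on `Option P`, where `none` plays the role of the
adjoined minimal element `0̂_Q` lying below exactly the elements of `Q`. -/
def extRel {P : Type*} (rP : P → P → Prop) (Q : Set P) : Option P → Option P → Prop
  | some x, some y => rP x y
  | none, some y => y ∈ Q
  | _, none => False

/-- The strict order of the poset suspension `Σ R` on `Bool ⊕ R`; `Sum.inl false` and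
`Sum.inl true` are the two adjoined elements `0̂_R` and `0̂'_R`, lying below every element
of `R` and incomparable with each other. -/
def suspRel {R : Type*} (rR : R → R → Prop) : Bool ⊕ R → Bool ⊕ R → Prop
  | Sum.inl _, Sum.inr _ => True
  | Sum.inr a, Sum.inr b => rR a b
  | _, _ => False

/-- The underlying set of the wedge of suspensions `⋁_{t ∈ T} Σ Rₜ`:
`none` is the adjoined minimal element `0̂`, `some (Sum.inl t)` is the element `t ∈ T`, and
`some (Sum.inr ⟨t, x⟩)` is the element `(x, t) ∈ Rₜ × {t}`. -/
abbrev WedgeP (T : Type*) (R : T → Type*) := Option (T ⊕ Σ t, R t)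

/-- The strict order of the wedge of suspensions of the posets `Rₜ`. -/
def wRel {T : Type*} {R : T → Type*} (r : ∀ t, R t → R t → Prop) :
    WedgeP T R → WedgeP T R → Prop
  | none, some (Sum.inr _) => True
  | some (Sum.inl t), some (Sum.inr b) => t = b.1
  | some (Sum.inr a), some (Sum.inr b) => ∃ h : a.1 = b.1, r b.1 (h ▸ a.2) b.2
  | _, _ => False

/-- The order complex of `(α, r)` restricted to the vertex set `S`: the abstract simplicial
complex whose simplices are the finite chains contained in `S`. -/
def cpx (α : Type*) (r : α → α → Prop) (S : Set α) : Set (Finset α) :=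
  {s | ↑s ⊆ S ∧ ∀ a ∈ s, ∀ b ∈ s, a ≠ b → r a b ∨ r b a}

/-- The full order complex of `(α, r)`. -/
abbrev fullCpx (α : Type*) (r : α → α → Prop) : Set (Finset α) := cpx α r Set.univ

theorem empty_mem_cpx (α : Type*) (r : α → α → Prop) (S : Set α) : ∅ ∈ cpx α r S := by
  simp [cpx]

/-- The length of the poset `(α, r)`: the supremum of the lengths of its chains. -/
noncomputable def posetLength (α : Type*) (r : α → α → Prop) : ℕ :=
  sSup {k : ℕ | Nonempty {f : Fin (k+1) → α // ∀ ⦃i j : Fin (k+1)⦄, i < j → r (f i) (f j)}}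

theorem extRel_map_QQ {P : Type*} {rP : P → P → Prop} {Q : Set P} :
    ∀ ⦃a b : Option ↥Q⦄,
      extRel (fun x y : ↥Q => rP x y) Set.univ a b →
        extRel rP Q (Option.map Subtype.val a) (Option.map Subtype.val b) := by
  intro a b h
  match a, b with
  | none, some b => exact b.2
  | some a, some b => exact h
  | none, none => exact h.elim
  | some _, none => exact h.elim

theorem extRel_optionMap {P : Type*} {rP : P → P → Prop} {Q : Set P} {f : P → P}
    (hf : ∀ ⦃a b⦄, rP a b → rP (f a) (f b)) (hfQ : ∀ ⦃q⦄, q ∈ Q → f q ∈ Q) :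
    ∀ ⦃a b : Option P⦄, extRel rP Q a b → extRel rP Q (Option.map f a) (Option.map f b) := by
  intro a b h
  match a, b with
  | none, some b => exact hfQ h
  | some a, some b => exact hf h
  | none, none => exact h.elim
  | some _, none => exact h.elim

theorem suspRel_map {R : Type*} {rR : R → R → Prop} {f : R → R}
    (hf : ∀ ⦃a b⦄, rR a b → rR (f a) (f b)) :
    ∀ ⦃a b : Bool ⊕ R⦄, suspRel rR a b → suspRel rR (Sum.map id f a) (Sum.map id f b) := by
  intro a b h
  match a, b with
  | Sum.inl x, Sum.inr b => trivial
  | Sum.inr a, Sum.inr b => exact hf h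
  | Sum.inl x, Sum.inl y => exact h.elim
  | Sum.inr a, Sum.inl y => exact h.elim

theorem wRel_map {T : Type*} {R : T → Type*} {r : ∀ t, R t → R t → Prop}
    (fT : T → T) (fR : ∀ t, R t → R (fT t))
    (hf : ∀ (t : T) ⦃a b : R t⦄, r t a b → r (fT t) (fR t a) (fR t b)) :
    ∀ ⦃a b : WedgeP T R⦄, wRel r a b →
      wRel r (Option.map (Sum.map fT (fun p => ⟨fT p.1, fR p.1 p.2⟩)) a)
        (Option.map (Sum.map fT (fun p => ⟨fT p.1, fR p.1 p.2⟩)) b) := by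
  rintro (_ | (t | ⟨t, x⟩)) (_ | (t' | ⟨t', y⟩)) h <;> try exact h.elim
  · trivial
  · exact congrArg fT h
  · obtain ⟨ht, hr⟩ := h
    dsimp only at ht hr
    subst ht
    exact ⟨rfl, hf t hr⟩

end PosetConstructions

section Homology

variable {α β γ δ : Type*} {rα : α → α → Prop} {rβ : β → β → Prop} {rγ : γ → γ → Prop}
  {rδ : δ → δ → Prop}

theorem bdry_cmapL_apply (f : α → β) (hf : ∀ ⦃a b⦄, rα a b → rβ (f a) (f b)) (n : ℕ)
    (z : ACh α rα (n + 1)) :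
    bdry β rβ n (cmapL f hf (n + 1) z) = cmapL f hf n (bdry α rα n z) :=
  LinearMap.congr_fun (bdry_cmapL f hf n) z

theorem mem_cyc {n : ℕ} {z : ACh α rα (n + 1)} : z ∈ cyc α rα n ↔ bdry α rα n z = 0 := Iff.rfl

theorem redH_mk_eq_zero {n : ℕ} {z : ACh α rα (n + 1)} (hz : z ∈ cyc α rα n) :
    (Submodule.Quotient.mk ⟨z, hz⟩ : redH α rα n) = 0 ↔ ∃ w, bdry α rα (n + 1) w = z :=
  Submodule.Quotient.mk_eq_zero _

theorem redH_mk_eq_mk {n : ℕ} {z z' : ACh α rα (n + 1)} (hz : z ∈ cyc α rα n)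
    (hz' : z' ∈ cyc α rα n) :
    (Submodule.Quotient.mk ⟨z, hz⟩ : redH α rα n) = Submodule.Quotient.mk ⟨z', hz'⟩ ↔
      ∃ w, bdry α rα (n + 1) w = z - z' :=
  Submodule.Quotient.eq _

theorem redH_ind {n : ℕ} {motive : redH α rα n → Prop}
    (mk : ∀ z (hz : z ∈ cyc α rα n), motive (Submodule.Quotient.mk ⟨z, hz⟩)) (x : redH α rα n) :
    motive x := by
  obtain ⟨⟨z, hz⟩, rfl⟩ := Submodule.Quotient.mk_surjective _ x
  exact mk z hz

theorem indH_mk (f : α → β) (hf : ∀ ⦃a b⦄, rα a b → rβ (f a) (f b)) {n : ℕ}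
    {z : ACh α rα (n + 1)} (hz : z ∈ cyc α rα n) :
    indH f hf n (Submodule.Quotient.mk ⟨z, hz⟩) =
      Submodule.Quotient.mk ⟨cmapL f hf (n + 1) z, cmapL_mem_cyc f hf hz⟩ := rfl

theorem cmapL_single (f : α → β) (hf : ∀ ⦃a b⦄, rα a b → rβ (f a) (f b)) {n : ℕ}
    (c : OCh α rα n) (m : ℤ) :
    cmapL f hf n (Finsupp.single c m) = Finsupp.single (cmap f hf c) m :=
  Finsupp.mapDomain_single

theorem coneL_single (f : α → β) (hf : ∀ ⦃a b⦄, rα a b → rβ (f a) (f b)) (b : β)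
    (hb : ∀ a : α, rβ b (f a)) {n : ℕ} (c : OCh α rα n) (m : ℤ) :
    coneL f hf b hb n (Finsupp.single c m) = Finsupp.single (coneMap f hf b hb c) m :=
  Finsupp.mapDomain_single

theorem cmapL_injective {f : α → β} (hf : ∀ ⦃a b⦄, rα a b → rβ (f a) (f b))
    (hinj : Function.Injective f) (n : ℕ) : Function.Injective (cmapL f hf n) :=
  Finsupp.mapDomain_injective fun c d h => by
    refine Subtype.ext (funext fun i => hinj ?_)
    exact congrFun (congrArg Subtype.val h) i

theorem coneMap_injective {f : α → β} (hf : ∀ ⦃a b⦄, rα a b → rβ (f a) (f b)) (b : β)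
    (hb : ∀ a : α, rβ b (f a)) (hinj : Function.Injective f) (n : ℕ) :
    Function.Injective (coneMap f hf b hb (n := n)) := fun c d h => by
  refine Subtype.ext (funext fun i => hinj ?_)
  simpa [coneMap] using congrFun (congrArg Subtype.val h) i.succ

/-- Commuting squares of relation-preserving maps induce commuting squares of chain groups. -/
theorem cmapL_comm {f : α → β} {g : β → δ} {f' : α → γ} {g' : γ → δ}
    (hf : ∀ ⦃a b⦄, rα a b → rβ (f a) (f b)) (hg : ∀ ⦃a b⦄, rβ a b → rδ (g a) (g b))
    (hf' : ∀ ⦃a b⦄, rα a b → rγ (f' a) (f' b)) (hg' : ∀ ⦃a b⦄, rγ a b → rδ (g' a) (g' b))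
    (h : ∀ a, g (f a) = g' (f' a)) {n : ℕ} (z : ACh α rα n) :
    cmapL g hg n (cmapL f hf n z) = cmapL g' hg' n (cmapL f' hf' n z) := by
  induction z using Finsupp.induction_linear with
  | zero => simp only [map_zero]
  | add x y hx hy => simp only [map_add, hx, hy]
  | single c m =>
    simp only [cmapL_single]
    congr 1
    exact Subtype.ext (funext fun i => h (c.1 i))

/-- Commuting squares of relation-preserving maps induce commuting squares in homology. -/
theorem indH_comm {f : α → β} {g : β → δ} {f' : α → γ} {g' : γ → δ}
    (hf : ∀ ⦃a b⦄, rα a b → rβ (f a) (f b)) (hg : ∀ ⦃a b⦄, rβ a b → rδ (g a) (g b))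
    (hf' : ∀ ⦃a b⦄, rα a b → rγ (f' a) (f' b)) (hg' : ∀ ⦃a b⦄, rγ a b → rδ (g' a) (g' b))
    (h : ∀ a, g (f a) = g' (f' a)) {n : ℕ} (x : redH α rα n) :
    indH g hg n (indH f hf n x) = indH g' hg' n (indH f' hf' n x) := by
  induction x using redH_ind with
  | mk z hz => simp only [indH_mk, cmapL_comm hf hg hf' hg' h]

/-- The boundary of a cone: `∂ (b * z) = z - b * ∂ z`. -/
theorem bdry_coneL (f : α → β) (hf : ∀ ⦃a b⦄, rα a b → rβ (f a) (f b)) (b : β)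
    (hb : ∀ a : α, rβ b (f a)) (n : ℕ) (z : ACh α rα (n + 1)) :
    bdry β rβ (n + 1) (coneL f hf b hb (n + 1) z) =
      cmapL f hf (n + 1) z - coneL f hf b hb n (bdry α rα n z) := by
  induction z using Finsupp.induction_linear with
  | zero => simp only [map_zero, sub_zero]
  | add x y hx hy => simp only [map_add, hx, hy]; abel
  | single c m =>
    have h0 : (coneMap f hf b hb c).face 0 = cmap f hf c :=
      Subtype.ext (funext fun i => by simp [OCh.face, coneMap, cmap])
    have hs : ∀ i : Fin (n + 1),
        (coneMap f hf b hb c).face i.succ = coneMap f hf b hb (c.face i) := fun i =>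
      Subtype.ext (funext fun k => by
        refine Fin.cases ?_ (fun k => ?_) k
        · simp [OCh.face, coneMap]
        · simp [OCh.face, coneMap, Fin.removeNth])
    rw [coneL_single, bdry_single, bdry_single, cmapL_single, Fin.sum_univ_succ, h0]
    simp only [hs, map_smul, map_sum, coneL_single, Fin.val_zero, pow_zero, one_smul,
      Fin.val_succ, pow_succ, mul_neg, mul_one, neg_smul, Finset.sum_neg_distrib,
      ← sub_eq_add_neg, Finsupp.smul_single, smul_eq_mul, smul_sub]

end Homology

section Extension

variable {P : Type*} (r : P → P → Prop) (Q : Set P)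

variable {r Q} in
theorem extRel_some ⦃a b : P⦄ (h : r a b) : extRel r Q (some a) (some b) := h

variable {r Q} in
theorem extRel_none (q : ↥Q) : extRel r Q none (some (q : P)) := q.2

/-- The cone operator `z ↦ 0̂_Q * z` from chains of `Q` to chains of `P_Q`. -/
noncomputable def extCone (n : ℕ) :
    ACh ↥Q (fun a b : ↥Q => r a b) n →ₗ[ℤ] ACh (Option P) (extRel r Q) (n + 1) :=
  coneL (fun q : ↥Q => some (q : P)) (fun _ _ h => extRel_some h) none extRel_none n

theorem extConeMap_injective (n : ℕ) : Function.Injective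
    (coneMap (rα := fun a b : ↥Q => r a b) (rβ := extRel r Q) (fun q : ↥Q => some (q : P))
      (fun _ _ h => extRel_some h) none extRel_none (n := n)) :=
  coneMap_injective _ _ _ ((Option.some_injective P).comp Subtype.val_injective) n

/-- The link operator, extracting from a chain of `P_Q` the chain `z` of `Q` such that
`0̂_Q * z` is the part of the given chain that involves `0̂_Q`. -/
noncomputable def extLink (n : ℕ) :
    ACh (Option P) (extRel r Q) (n + 1) →ₗ[ℤ] ACh ↥Q (fun a b : ↥Q => r a b) n :=
  Finsupp.lcomapDomain _ (extConeMap_injective r Q n)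

/-- The chain map induced by the inclusion of `P` into `P_Q`. -/
noncomputable abbrev extSome (n : ℕ) : ACh P r n →ₗ[ℤ] ACh (Option P) (extRel r Q) n :=
  cmapL some extRel_some n

/-- The chain map induced by the inclusion of `Q` into `P`. -/
noncomputable abbrev extVal (n : ℕ) : ACh ↥Q (fun a b : ↥Q => r a b) n →ₗ[ℤ] ACh P r n :=
  cmapL Subtype.val (fun _ _ h => h) n

theorem extSome_injective (n : ℕ) : Function.Injective (extSome r Q n) :=
  cmapL_injective _ (Option.some_injective P) n

theorem extVal_injective (n : ℕ) : Function.Injective (extVal r Q n) :=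
  cmapL_injective _ Subtype.val_injective n

theorem bdry_extCone (n : ℕ) (z : ACh ↥Q (fun a b : ↥Q => r a b) (n + 1)) :
    bdry _ _ (n + 1) (extCone r Q (n + 1) z) =
      extSome r Q (n + 1) (extVal r Q (n + 1) z) - extCone r Q n (bdry _ _ n z) := by
  rw [extCone, bdry_coneL]
  congr 1
  exact (Finsupp.mapDomain_comp (v := z) (f := cmap (rβ := r) Subtype.val fun _ _ h => h)
    (g := cmap (rα := r) (rβ := extRel r Q) some extRel_some))

theorem extLink_extCone (n : ℕ) (z : ACh ↥Q (fun a b : ↥Q => r a b) n) :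
    extLink r Q n (extCone r Q n z) = z :=
  Finsupp.comapDomain_mapDomain _ (extConeMap_injective r Q n) z

theorem extLink_extSome (n : ℕ) (a : ACh P r (n + 1)) :
    extLink r Q n (extSome r Q (n + 1) a) = 0 := by
  ext c
  refine Finsupp.mapDomain_of_notMem_range a _ ?_
  rintro ⟨d, hd⟩
  simpa [cmap, coneMap] using congrFun (congrArg Subtype.val hd) 0

theorem OCh.exists_of_extRel {n : ℕ} (c : OCh (Option P) (extRel r Q) (n + 1)) :
    (∃ d : OCh P r (n + 1), cmap some extRel_some d = c) ∨
      ∃ d : OCh ↥Q (fun a b : ↥Q => r a b) n,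
        coneMap (fun q : ↥Q => some (q : P)) (fun _ _ h => extRel_some h) none extRel_none d = c := by
  have hsucc : ∀ i : Fin n, ∃ p, c.1 i.succ = some p ∧ (c.1 0 = none → p ∈ Q) := by
    intro i
    have h := c.2 (Fin.succ_pos i)
    cases hp : c.1 i.succ with
    | none => rw [hp] at h; cases h0 : c.1 0 <;> rw [h0] at h <;> exact h.elim
    | some p =>
      refine ⟨p, rfl, fun h0 => ?_⟩
      rw [h0, hp] at h
      exact h
  choose p hp hpQ using hsucc
  have hlt : ∀ ⦃i j : Fin n⦄, i < j → r (p i) (p j) := fun i j hij => by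
    have h := c.2 (Fin.succ_lt_succ_iff.2 hij)
    rw [hp, hp] at h
    exact h
  cases h0 : c.1 0 with
  | none =>
    refine Or.inr ⟨⟨fun i => ⟨p i, hpQ i h0⟩, fun i j hij => hlt hij⟩, ?_⟩
    refine Subtype.ext (funext fun i => ?_)
    refine Fin.cases ?_ (fun i => ?_) i <;> simp [coneMap, h0, hp]
  | some x =>
    have hc : ∀ i, c.1 i = some ((Fin.cons x p : Fin (n + 1) → P) i) := fun i => by
      refine Fin.cases ?_ (fun i => ?_) i <;> simp [h0, hp]
    refine Or.inl ⟨⟨Fin.cons x p, fun i j hij => ?_⟩, Subtype.ext (funext fun i => (hc i).symm)⟩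
    have h := c.2 hij
    rw [hc, hc] at h
    exact h

theorem exists_eq_extSome_add_extCone {n : ℕ} (e : ACh (Option P) (extRel r Q) (n + 1)) :
    ∃ a u, e = extSome r Q (n + 1) a + extCone r Q n u := by
  induction e using Finsupp.induction_linear with
  | zero => exact ⟨0, 0, by simp only [map_zero, add_zero]⟩
  | add x y hx hy =>
    obtain ⟨a, u, rfl⟩ := hx
    obtain ⟨a', u', rfl⟩ := hy
    exact ⟨a + a', u + u', by simp only [map_add]; abel⟩
  | single c m =>
    rcases OCh.exists_of_extRel r Q c with ⟨d, rfl⟩ | ⟨d, rfl⟩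
    · exact ⟨Finsupp.single d m, 0, by rw [map_zero, add_zero, cmapL_single]⟩
    · exact ⟨0, Finsupp.single d m, by rw [map_zero, zero_add, extCone, coneL_single]⟩

theorem extLink_extSome_add_extCone {n : ℕ} (a : ACh P r (n + 1))
    (u : ACh ↥Q (fun a b : ↥Q => r a b) n) :
    extLink r Q n (extSome r Q (n + 1) a + extCone r Q n u) = u := by
  rw [map_add, extLink_extSome, extLink_extCone, zero_add]

theorem bdry_extSome_add_extCone {n : ℕ} (a : ACh P r (n + 2))
    (u : ACh ↥Q (fun a b : ↥Q => r a b) (n + 1)) :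
    bdry _ _ (n + 1) (extSome r Q (n + 2) a + extCone r Q (n + 1) u) =
      extSome r Q (n + 1) (bdry _ _ (n + 1) a + extVal r Q (n + 1) u) +
        extCone r Q n (-bdry _ _ n u) := by
  rw [map_add, bdry_cmapL_apply, bdry_extCone, map_add, map_neg]
  abel

theorem extSome_add_extCone_inj {n : ℕ} {a a' : ACh P r (n + 1)}
    {u u' : ACh ↥Q (fun a b : ↥Q => r a b) n}
    (h : extSome r Q (n + 1) a + extCone r Q n u = extSome r Q (n + 1) a' + extCone r Q n u') :
    a = a' ∧ u = u' := by
  have hu := congrArg (extLink r Q n) h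
  rw [extLink_extSome_add_extCone, extLink_extSome_add_extCone] at hu
  subst hu
  exact ⟨extSome_injective r Q _ (add_right_cancel h), rfl⟩

theorem extSome_add_extCone_mem_cyc {n : ℕ} {a : ACh P r (n + 2)}
    {u : ACh ↥Q (fun a b : ↥Q => r a b) (n + 1)} :
    extSome r Q (n + 2) a + extCone r Q (n + 1) u ∈ cyc (Option P) (extRel r Q) (n + 1) ↔
      bdry _ _ (n + 1) a + extVal r Q (n + 1) u = 0 ∧ bdry _ _ n u = 0 := by
  rw [mem_cyc, bdry_extSome_add_extCone]
  constructor
  · intro h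
    have h' := extSome_add_extCone_inj r Q (a' := 0) (u' := 0) (by simpa only [map_zero, add_zero])
    exact ⟨h'.1, neg_eq_zero.1 h'.2⟩
  · rintro ⟨h, h'⟩
    rw [h, h', neg_zero, map_zero, map_zero, add_zero]

theorem bdry_extLink {n : ℕ} (e : ACh (Option P) (extRel r Q) (n + 2)) :
    bdry _ _ n (extLink r Q (n + 1) e) = -extLink r Q n (bdry _ _ (n + 1) e) := by
  obtain ⟨a, u, rfl⟩ := exists_eq_extSome_add_extCone r Q e
  rw [bdry_extSome_add_extCone, extLink_extSome_add_extCone, extLink_extSome_add_extCone, neg_neg]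

theorem neg_extLink_mem_cyc {n : ℕ} {e : ACh (Option P) (extRel r Q) (n + 2)}
    (he : e ∈ cyc _ _ (n + 1)) : (-extLink r Q (n + 1)) e ∈ cyc _ _ n := by
  rw [mem_cyc] at he ⊢
  rw [LinearMap.neg_apply, map_neg, bdry_extLink, he, map_zero, neg_zero, neg_zero]

/-- The connecting homomorphism `H̃ₙ₊₁(P_Q) → H̃ₙ(Q)`. -/
noncomputable def connectingHom (n : ℕ) :
    redH (Option P) (extRel r Q) (n + 1) →ₗ[ℤ] redH ↥Q (fun a b : ↥Q => r a b) n :=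
  Submodule.mapQ _ _ ((-extLink r Q (n + 1)).restrict fun _ he => neg_extLink_mem_cyc r Q he) (by
    rintro ⟨z, hz⟩ ⟨w, hw⟩
    exact ⟨extLink r Q (n + 2) w, (bdry_extLink r Q w).trans
      (congrArg (fun x => -extLink r Q (n + 1) x) hw)⟩)

theorem connectingHom_mk {n : ℕ} {e : ACh (Option P) (extRel r Q) (n + 2)}
    (he : e ∈ cyc _ _ (n + 1)) :
    connectingHom r Q n (Submodule.Quotient.mk ⟨e, he⟩) =
      Submodule.Quotient.mk ⟨(-extLink r Q (n + 1)) e, neg_extLink_mem_cyc r Q he⟩ := rfl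

theorem exact_indH_val_indH_some (n : ℕ) : Function.Exact
    (indH (rα := fun a b : ↥Q => r a b) (rβ := r) (Subtype.val : ↥Q → P) (fun _ _ h => h) n)
    (indH (rα := r) (rβ := extRel r Q) (some : P → Option P) extRel_some n) := by
  intro x
  induction x using redH_ind with | mk z hz => ?_
  rw [indH_mk, redH_mk_eq_zero]
  constructor
  · rintro ⟨e, he⟩
    obtain ⟨a, u, rfl⟩ := exists_eq_extSome_add_extCone r Q e
    rw [bdry_extSome_add_extCone] at he
    obtain ⟨h, h'⟩ := extSome_add_extCone_inj r Q (a' := z) (u' := 0)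
      (he.trans (by rw [map_zero, add_zero]))
    refine ⟨Submodule.Quotient.mk ⟨u, mem_cyc.2 (neg_eq_zero.1 h')⟩, ?_⟩
    rw [indH_mk, redH_mk_eq_mk]
    exact ⟨-a, by rw [map_neg, ← h]; abel⟩
  · rintro ⟨y, hy⟩
    induction y using redH_ind with | mk u hu => ?_
    rw [indH_mk, redH_mk_eq_mk] at hy
    obtain ⟨a, ha⟩ := hy
    refine ⟨extSome r Q _ (-a) + extCone r Q _ u, ?_⟩
    rw [bdry_extSome_add_extCone, mem_cyc.1 hu, neg_zero, map_zero, add_zero, map_neg, ha]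
    congr 1
    abel

theorem exact_indH_some_connectingHom (n : ℕ) : Function.Exact
    (indH (rα := r) (rβ := extRel r Q) (some : P → Option P) extRel_some (n + 1))
    (connectingHom r Q n) := by
  intro x
  induction x using redH_ind with | mk e he => ?_
  rw [connectingHom_mk, redH_mk_eq_zero]
  constructor
  · rintro ⟨v, hv⟩
    obtain ⟨a, u, rfl⟩ := exists_eq_extSome_add_extCone r Q e
    rw [LinearMap.neg_apply, extLink_extSome_add_extCone] at hv
    have hu : u = -bdry _ _ (n + 1) v := by rw [hv, neg_neg]
    obtain ⟨h, -⟩ := (extSome_add_extCone_mem_cyc r Q).1 he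
    have ha : a - extVal r Q _ v ∈ cyc P r (n + 1) := by
      rw [mem_cyc, map_sub, bdry_cmapL_apply, hv, map_neg, sub_neg_eq_add, h]
    refine ⟨Submodule.Quotient.mk ⟨_, ha⟩, ?_⟩
    rw [indH_mk, redH_mk_eq_mk]
    refine ⟨-extCone r Q _ v, ?_⟩
    rw [map_neg, bdry_extCone, hv, map_sub, map_neg]
    abel
  · rintro ⟨y, hy⟩
    induction y using redH_ind with | mk z hz => ?_
    rw [indH_mk, redH_mk_eq_mk] at hy
    obtain ⟨w, hw⟩ := hy
    refine ⟨-extLink r Q _ w, ?_⟩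
    rw [map_neg, bdry_extLink, hw, map_sub, extLink_extSome, zero_sub, neg_neg,
      LinearMap.neg_apply]

theorem exact_connectingHom_indH_val (n : ℕ) : Function.Exact (connectingHom r Q n)
    (indH (rα := fun a b : ↥Q => r a b) (rβ := r) (Subtype.val : ↥Q → P)
      (fun _ _ h => h) n) := by
  intro x
  induction x using redH_ind with | mk w hw => ?_
  rw [indH_mk, redH_mk_eq_zero]
  constructor
  · rintro ⟨a, ha⟩
    have he : extSome r Q _ a + extCone r Q _ (-w) ∈ cyc (Option P) (extRel r Q) (n + 1) := by
      rw [extSome_add_extCone_mem_cyc, ha, map_neg, map_neg, mem_cyc.1 hw]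
      exact ⟨add_neg_cancel _, neg_zero⟩
    refine ⟨Submodule.Quotient.mk ⟨_, he⟩, ?_⟩
    rw [connectingHom_mk, redH_mk_eq_mk]
    refine ⟨0, ?_⟩
    rw [LinearMap.neg_apply, extLink_extSome_add_extCone, neg_neg, map_zero, sub_self]
  · rintro ⟨y, hy⟩
    induction y using redH_ind with | mk e he => ?_
    obtain ⟨a, u, rfl⟩ := exists_eq_extSome_add_extCone r Q e
    obtain ⟨h, -⟩ := (extSome_add_extCone_mem_cyc r Q).1 he
    rw [connectingHom_mk, redH_mk_eq_mk] at hy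
    obtain ⟨v, hv⟩ := hy
    rw [LinearMap.neg_apply, extLink_extSome_add_extCone] at hv
    refine ⟨a - extVal r Q _ v, ?_⟩
    rw [map_sub, bdry_cmapL_apply, hv, map_sub, map_neg, eq_neg_of_add_eq_zero_left h]
    abel

variable {r Q} {P' : Type*} {r' : P' → P' → Prop} {Q' : Set P'}

/-- Naturality of the inclusion of `P` into `P_Q`. -/
theorem cmapL_extSome {f : P → P'} (hf : ∀ ⦃a b⦄, r a b → r' (f a) (f b))
    (hF : ∀ ⦃a b⦄, extRel r Q a b → extRel r' Q' (Option.map f a) (Option.map f b)) {n : ℕ}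
    (a : ACh P r n) :
    cmapL (Option.map f) hF n (extSome r Q n a) = extSome r' Q' n (cmapL f hf n a) :=
  cmapL_comm extRel_some hF hf extRel_some (fun _ => rfl) a

/-- Naturality of the cone operator. -/
theorem cmapL_extCone {f : P → P'} (hQ : ∀ q : ↥Q, f q ∈ Q')
    (hf : ∀ ⦃a b : ↥Q⦄, r a b → r' (f a) (f b))
    (hF : ∀ ⦃a b⦄, extRel r Q a b → extRel r' Q' (Option.map f a) (Option.map f b)) {n : ℕ}
    (u : ACh ↥Q (fun a b : ↥Q => r a b) n) :
    cmapL (Option.map f) hF (n + 1) (extCone r Q n u) =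
      extCone r' Q' n (cmapL (fun q : ↥Q => (⟨f q, hQ q⟩ : ↥Q')) hf n u) := by
  induction u using Finsupp.induction_linear with
  | zero => simp only [map_zero]
  | add x y hx hy => simp only [map_add, hx, hy]
  | single c m =>
    simp only [cmapL_single, extCone, coneL_single]
    congr 1
    refine Subtype.ext (funext fun i => ?_)
    refine Fin.cases ?_ (fun i => ?_) i <;> simp [coneMap, cmap]

/-- Naturality of the connecting homomorphism. -/
theorem connectingHom_indH {f : P → P'} (hQ : ∀ q : ↥Q, f q ∈ Q')
    (hf : ∀ ⦃a b⦄, r a b → r' (f a) (f b))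
    (hF : ∀ ⦃a b⦄, extRel r Q a b → extRel r' Q' (Option.map f a) (Option.map f b)) {n : ℕ}
    (x : redH (Option P) (extRel r Q) (n + 1)) :
    connectingHom r' Q' n (indH (Option.map f) hF (n + 1) x) =
      indH (rβ := fun a b : ↥Q' => r' a b) (fun q : ↥Q => (⟨f q, hQ q⟩ : ↥Q'))
        (fun _ _ h => hf h) n (connectingHom r Q n x) := by
  induction x using redH_ind with | mk e he => ?_
  obtain ⟨a, u, rfl⟩ := exists_eq_extSome_add_extCone r Q e
  have hsome := cmapL_extSome hf hF a
  have hcone := cmapL_extCone hQ (fun _ _ h => hf h) hF u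
  simp only [indH_mk, connectingHom_mk, LinearMap.neg_apply, map_add, hsome, hcone,
    extLink_extSome, extLink_extCone, map_neg, neg_zero, zero_add]

theorem connectingHom_mk_add {n : ℕ} {a : ACh P r (n + 2)}
    {b : ACh (Option ↥Q) (extRel (fun x y : ↥Q => r x y) Set.univ) (n + 2)}
    (hz : extSome r Q (n + 2) a + cmapL (Option.map (Subtype.val : ↥Q → P)) extRel_map_QQ (n + 2) b
      ∈ cyc (Option P) (extRel r Q) (n + 1))
    {w : ACh ↥Q (fun x y : ↥Q => r x y) (n + 1)} (hw : w ∈ cyc _ _ n)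
    (h : extVal r Q (n + 1) w = bdry P r (n + 1) a) :
    connectingHom r Q n (Submodule.Quotient.mk ⟨_, hz⟩) = Submodule.Quotient.mk ⟨w, hw⟩ := by
  obtain ⟨b, v, rfl⟩ := exists_eq_extSome_add_extCone _ _ b
  have hsome := cmapL_extSome (r := fun x y : ↥Q => r x y) (r' := r) (Q := Set.univ) (Q' := Q)
    (f := Subtype.val) (fun _ _ h => h) extRel_map_QQ b
  obtain ⟨u, hcone⟩ : ∃ u, cmapL (Option.map (Subtype.val : ↥Q → P)) extRel_map_QQ (n + 2)
      (extCone (fun x y : ↥Q => r x y) Set.univ (n + 1) v) = extCone r Q (n + 1) u :=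
    ⟨_, cmapL_extCone (r' := r) (Q' := Q) (f := Subtype.val) (fun q => q.1.2) (fun _ _ h => h)
      extRel_map_QQ v⟩
  have hsum : extSome r Q (n + 2) a + cmapL (Option.map (Subtype.val : ↥Q → P)) extRel_map_QQ
      (n + 2) (extSome (fun x y : ↥Q => r x y) Set.univ (n + 2) b + extCone _ _ _ v) =
      extSome r Q (n + 2) (a + extVal r Q (n + 2) b) + extCone r Q _ u := by
    rw [map_add, map_add, hsome, hcone]
    exact (add_assoc _ _ _).symm
  rw [hsum, extSome_add_extCone_mem_cyc, map_add, bdry_cmapL_apply, ← h, ← map_add, ← map_add]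
    at hz
  have hwu := extVal_injective r Q _ (hz.1.trans (map_zero _).symm)
  rw [connectingHom_mk, redH_mk_eq_mk]
  refine ⟨b, ?_⟩
  rw [LinearMap.neg_apply, hsum, extLink_extSome_add_extCone, eq_sub_iff_add_eq,
    ← add_eq_zero_iff_eq_neg, ← hwu]
  abel

end Extension

/-- Segev–Webb, Proposition 1.1(ii).  The Mayer–Vietoris long exact
sequence `⋯ → H̃ₙ(Q) → H̃ₙ(P) → H̃ₙ(P_Q) → H̃ₙ₋₁(Q) → ⋯` of an extension `P` of `Q`,
with the first two maps induced by the inclusions `Q ↪ P` and `P ↪ P_Q`, the connecting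
map `r` given by `r [α + β] = [∂ α]`, and all maps `G`-equivariant when `P` is a `G`-poset
with `Q` stable under `G`. -/
theorem statement1 {P : Type*} [PartialOrder P] [Finite P]
    {G : Type*} [Group G] [MulAction G P]
    (hsmul : ∀ (g : G) ⦃x y : P⦄, x < y → g • x < g • y)
    (Q : Set P)
    (hQupper : ∀ q ∈ Q, ∀ p : P, q ≤ p → p ∈ Q)
    (hQext : ∀ p : P, ∃ q ∈ Q, p ≤ q)
    (hQG : ∀ (g : G) (q : P), q ∈ Q → g • q ∈ Q) :
    ∃ r : ∀ n : ℕ, redH (Option P) (extRel (· < ·) Q) (n + 1) →ₗ[ℤ]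
        redH ↥Q (fun a b : ↥Q => (a : P) < (b : P)) n,
      -- exactness at H̃ₙ(P):  H̃ₙ(Q) → H̃ₙ(P) → H̃ₙ(P_Q)
      (∀ n : ℕ, Function.Exact
        (indH (rα := fun a b : ↥Q => (a : P) < (b : P)) (rβ := ((· < ·) : P → P → Prop))
          (Subtype.val : ↥Q → P) (fun _ _ h => h) n)
        (indH (rα := ((· < ·) : P → P → Prop)) (rβ := extRel (· < ·) Q)
          (some : P → Option P) (fun _ _ h => h) n)) ∧
      -- exactness at H̃ₙ₊₁(P_Q):  H̃ₙ₊₁(P) → H̃ₙ₊₁(P_Q) → H̃ₙ(Q)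
      (∀ n : ℕ, Function.Exact
        (indH (rα := ((· < ·) : P → P → Prop)) (rβ := extRel (· < ·) Q)
          (some : P → Option P) (fun _ _ h => h) (n + 1)) (r n)) ∧
      -- exactness at H̃ₙ(Q):  H̃ₙ₊₁(P_Q) → H̃ₙ(Q) → H̃ₙ(P)
      (∀ n : ℕ, Function.Exact (r n)
        (indH (rα := fun a b : ↥Q => (a : P) < (b : P)) (rβ := ((· < ·) : P → P → Prop))
          (Subtype.val : ↥Q → P) (fun _ _ h => h) n)) ∧
      -- the connecting homomorphism is given by `r [α + β] = [∂ α]`, where `α` is an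
      -- augmented chain of `P`, `β` one of `Q_Q`, and `∂ (α + β) = 0` in `P_Q`
      (∀ (n : ℕ) (a : ACh P (· < ·) (n + 2))
        (b : ACh (Option ↥Q) (extRel (fun x y : ↥Q => (x : P) < (y : P)) Set.univ) (n + 2))
        (hz : cmapL (rα := ((· < ·) : P → P → Prop)) (rβ := extRel (· < ·) Q)
            (some : P → Option P) (fun _ _ h => h) (n + 2) a +
            cmapL (rα := extRel (fun x y : ↥Q => (x : P) < (y : P)) Set.univ)
              (rβ := extRel (· < ·) Q)
              (Option.map (Subtype.val : ↥Q → P)) extRel_map_QQ (n + 2) b ∈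
          cyc (Option P) (extRel (· < ·) Q) (n + 1))
        (w : ACh ↥Q (fun x y : ↥Q => (x : P) < (y : P)) (n + 1))
        (hw : w ∈ cyc ↥Q (fun x y : ↥Q => (x : P) < (y : P)) n),
        cmapL (rα := fun x y : ↥Q => (x : P) < (y : P)) (rβ := ((· < ·) : P → P → Prop))
            (Subtype.val : ↥Q → P) (fun _ _ h => h) (n + 1) w =
            bdry P (· < ·) (n + 1) a →
        r n (Submodule.Quotient.mk ⟨_, hz⟩) = Submodule.Quotient.mk ⟨w, hw⟩) ∧
      -- the sequence is one of `ℤG`-modules: all three maps are `G`-equivariant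
      (∀ (g : G) (n : ℕ) (x : redH ↥Q (fun a b : ↥Q => (a : P) < (b : P)) n),
        indH (rα := fun a b : ↥Q => (a : P) < (b : P)) (rβ := ((· < ·) : P → P → Prop))
            (Subtype.val : ↥Q → P) (fun _ _ h => h) n
            (indH (rα := fun a b : ↥Q => (a : P) < (b : P))
              (rβ := fun a b : ↥Q => (a : P) < (b : P))
              (fun q : ↥Q => (⟨g • (q : P), hQG g q q.2⟩ : ↥Q))
              (fun _ _ h => hsmul g h) n x) =
          indH (rα := ((· < ·) : P → P → Prop)) (rβ := ((· < ·) : P → P → Prop))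
            ((g • ·) : P → P) (hsmul g) n
            (indH (rα := fun a b : ↥Q => (a : P) < (b : P)) (rβ := ((· < ·) : P → P → Prop))
              (Subtype.val : ↥Q → P) (fun _ _ h => h) n x)) ∧
      (∀ (g : G) (n : ℕ) (x : redH P (· < ·) n),
        indH (rα := ((· < ·) : P → P → Prop)) (rβ := extRel (· < ·) Q)
            (some : P → Option P) (fun _ _ h => h) n
            (indH (rα := ((· < ·) : P → P → Prop)) (rβ := ((· < ·) : P → P → Prop))
              ((g • ·) : P → P) (hsmul g) n x) =
          indH (rα := extRel (· < ·) Q) (rβ := extRel (· < ·) Q)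
              (Option.map ((g • ·) : P → P))
              (extRel_optionMap (hsmul g) (fun q hq => hQG g q hq)) n
            (indH (rα := ((· < ·) : P → P → Prop)) (rβ := extRel (· < ·) Q)
              (some : P → Option P) (fun _ _ h => h) n x)) ∧
      (∀ (g : G) (n : ℕ) (x : redH (Option P) (extRel (· < ·) Q) (n + 1)),
        r n (indH (rα := extRel (· < ·) Q) (rβ := extRel (· < ·) Q)
            (Option.map ((g • ·) : P → P))
            (extRel_optionMap (hsmul g) (fun q hq => hQG g q hq)) (n + 1) x) =
          indH (rα := fun a b : ↥Q => (a : P) < (b : P))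
            (rβ := fun a b : ↥Q => (a : P) < (b : P))
            (fun q : ↥Q => (⟨g • (q : P), hQG g q q.2⟩ : ↥Q))
            (fun _ _ h => hsmul g h) n (r n x)) := by
  exact ⟨connectingHom (· < ·) Q, exact_indH_val_indH_some _ Q,
    exact_indH_some_connectingHom _ Q, exact_connectingHom_indH_val _ Q,
    fun n a b hz w hw h => connectingHom_mk_add hz hw h,
    fun g n x => indH_comm (rβ := fun a b : ↥Q => (a : P) < (b : P))
      (f := fun q : ↥Q => (⟨g • (q : P), hQG g q q.2⟩ : ↥Q)) (g := Subtype.val)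
      (fun _ _ h => hsmul g h) (fun _ _ h => h) (fun _ _ h => h) (hsmul g) (fun _ => rfl) x,
    fun g n x => indH_comm (hsmul g) extRel_some extRel_some
      (extRel_optionMap (hsmul g) (fun q hq => hQG g q hq)) (fun _ => rfl) x,
    fun g n x => connectingHom_indH (fun q => hQG g q q.2) (hsmul g)
      (extRel_optionMap (hsmul g) (fun q hq => hQG g q hq)) x⟩
end

section
/- Let G be a group, P a finite G-poset which is an extension of a G-stable subposet Q by minimal elements, and let M = P \ Q. Define j : wedge_{m in M} Sigma P_{>m} -> P_Q by j(x,m) = x for (x,m) in P_{>m} x {m}, j(m) = m for m in M, and j(0hat) = 0hat_Q. Then j is a G-homotopy equivalence of G-posets. -/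
section Realization

/-- The geometric realization of an abstract simplicial complex `K` with vertex set `α`,
as a subspace of `α → ℝ`. -/
def Rl {α : Type*} (K : Set (Finset α)) : Set (α → ℝ) :=
  {w | (∀ a, 0 ≤ w a) ∧ ∃ s ∈ K, (∀ a, w a ≠ 0 → a ∈ s) ∧ ∑ a ∈ s, w a = 1}

/-- The two-point simplicial complex (two distinct isolated vertices). -/
def twoPt : Set (Finset Bool) := {s | s.card ≤ 1}

/-- The join of two abstract simplicial complexes. -/
def joinCpx {α β : Type*} [DecidableEq α] [DecidableEq β]
    (K : Set (Finset α)) (L : Set (Finset β)) : Set (Finset (α ⊕ β)) :=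
  {u | ∃ s ∈ K, ∃ t ∈ L,
    u = s.map ⟨Sum.inl, Sum.inl_injective⟩ ∪ t.map ⟨Sum.inr, Sum.inr_injective⟩}

/-- The relation identifying the basepoints of a family of pointed spaces. -/
def wedgeSetoid {T : Type*} (X : T → Type*) (pt : ∀ t, X t) : Setoid (Σ t, X t) where
  r a b := a = b ∨ (a.2 = pt a.1 ∧ b.2 = pt b.1)
  iseqv := by
    refine ⟨fun _ => Or.inl rfl, ?_, ?_⟩
    · rintro a b (rfl | ⟨h1, h2⟩)
      · exact Or.inl rfl
      · exact Or.inr ⟨h2, h1⟩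
    · rintro a b c (rfl | ⟨h1, h2⟩) (rfl | ⟨h3, h4⟩)
      · exact Or.inl rfl
      · exact Or.inr ⟨h3, h4⟩
      · exact Or.inr ⟨h1, h2⟩
      · exact Or.inr ⟨h1, h4⟩

/-- The wedge (one-point union) of a family of pointed topological spaces. -/
def WedgeSpace {T : Type*} (X : T → Type*) [∀ t, TopologicalSpace (X t)] (pt : ∀ t, X t) :=
  Quotient (wedgeSetoid X pt)

noncomputable instance {T : Type*} (X : T → Type*) [∀ t, TopologicalSpace (X t)]
    (pt : ∀ t, X t) : TopologicalSpace (WedgeSpace X pt) := by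
  unfold WedgeSpace; infer_instance

/-- The basepoint (the vertex `0̂` of the suspension) in the realization of the simplicial
suspension of a complex `L`. -/
noncomputable def suspBase {β : Type*} [DecidableEq β] (L : Set (Finset β)) (hL : ∅ ∈ L) :
    ↥(Rl (joinCpx twoPt L)) :=
  ⟨fun a => if a = Sum.inl false then 1 else 0, by
    refine ⟨fun a => ?_, {Sum.inl false}, ⟨{false}, by simp [twoPt], ∅, hL, by simp⟩, ?_, by simp⟩
    · simp only []
      split <;> norm_num
    · intro a ha
      simp only [Finset.mem_singleton]
      by_contra h
      exact ha (if_neg h)⟩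

/-- A basepoint on the `ℓ`-dimensional unit sphere. -/
noncomputable def spherePt (ℓ : ℕ) : ↥(Metric.sphere (0 : EuclideanSpace ℝ (Fin (ℓ+1))) 1) :=
  ⟨EuclideanSpace.single 0 1, by simp⟩

/-- The bouquet (wedge) of `N` spheres of dimension `ℓ`. -/
noncomputable def Bouquet (N ℓ : ℕ) : Type :=
  WedgeSpace (fun _ : Fin N => ↥(Metric.sphere (0 : EuclideanSpace ℝ (Fin (ℓ+1))) 1))
    (fun _ => spherePt ℓ)

noncomputable instance (N ℓ : ℕ) : TopologicalSpace (Bouquet N ℓ) := by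
  unfold Bouquet WedgeSpace; infer_instance

end Realization

section ExtensionByMinimal

/-- `M = P \ Q`: the set of adjoined minimal elements. -/
def Mset {P : Type*} (Q : Set P) : Set P := {p | p ∉ Q}

/-- The subposet `P_{> m}` of elements strictly above `m`. -/
abbrev PgtT {P : Type*} [PartialOrder P] {Q : Set P} (m : ↥(Mset Q)) :=
  {x : P // (m : P) < x}

/-- The (strict) order of `P_{> m}`. -/
def rgt {P : Type*} [PartialOrder P] {Q : Set P} (m : ↥(Mset Q)) :
    PgtT m → PgtT m → Prop := fun a b => (a : P) < (b : P)

/-- The wedge of suspensions `⋁_{m ∈ M} Σ P_{>m}` (underlying set). -/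
abbrev WT (P : Type*) [PartialOrder P] (Q : Set P) :=
  WedgeP ↥(Mset Q) (fun m => PgtT m)

/-- The (strict) order of `⋁_{m ∈ M} Σ P_{>m}`. -/
def wrelT (P : Type*) [PartialOrder P] (Q : Set P) : WT P Q → WT P Q → Prop :=
  wRel (fun m => rgt m)

/-- The action of `g ∈ G` on `M = P \ Q`. -/
def gMe {P : Type*} {G : Type*} [Group G] [MulAction G P] {Q : Set P}
    (hQG : ∀ (g : G) (q : P), q ∈ Q → g • q ∈ Q) (g : G) (m : ↥(Mset Q)) : ↥(Mset Q) :=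
  ⟨g • (m : P), fun hq => m.2 (by simpa using hQG g⁻¹ _ hq)⟩

/-- The action of `g ∈ G` on the vertices of `⋁_{m ∈ M} Σ P_{>m}`
(`g • (p, m) = (g • p, g • m)`, `g • m = g • m`, `g • 0̂ = 0̂`). -/
def wVer {P : Type*} [PartialOrder P] {G : Type*} [Group G] [MulAction G P] {Q : Set P}
    (hsmul : ∀ (g : G) ⦃x y : P⦄, x < y → g • x < g • y)
    (hQG : ∀ (g : G) (q : P), q ∈ Q → g • q ∈ Q) (g : G) : WT P Q → WT P Q :=
  Option.map (Sum.map (gMe hQG g)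
    (fun p => ⟨gMe hQG g p.1, (⟨g • (p.2 : P), hsmul g p.2.2⟩ : PgtT (gMe hQG g p.1))⟩))

theorem wVer_mono {P : Type*} [PartialOrder P] {G : Type*} [Group G] [MulAction G P]
    {Q : Set P} (hsmul : ∀ (g : G) ⦃x y : P⦄, x < y → g • x < g • y)
    (hQG : ∀ (g : G) (q : P), q ∈ Q → g • q ∈ Q) (g : G) :
    ∀ ⦃a b : WT P Q⦄, wrelT P Q a b → wrelT P Q (wVer hsmul hQG g a) (wVer hsmul hQG g b) :=
  wRel_map (gMe hQG g)
    (fun (m : ↥(Mset Q)) (x : PgtT m) => (⟨g • (x : P), hsmul g x.2⟩ : PgtT (gMe hQG g m)))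
    (fun _ _ _ h => hsmul g h)

/-- The map from the fibre of the wedge at `g • m` to the fibre at `m` induced by `g⁻¹`
(on suspension vertex sets). -/
def fVer {P : Type*} [PartialOrder P] {G : Type*} [Group G] [MulAction G P] {Q : Set P}
    (hsmul : ∀ (g : G) ⦃x y : P⦄, x < y → g • x < g • y)
    (hQG : ∀ (g : G) (q : P), q ∈ Q → g • q ∈ Q) (g : G) (m : ↥(Mset Q)) :
    Bool ⊕ PgtT (gMe hQG g m) → Bool ⊕ PgtT m :=
  Sum.map id fun p => ⟨g⁻¹ • (p : P), by simpa [gMe] using hsmul g⁻¹ p.2⟩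

end ExtensionByMinimal

/-- The poset map `j : ⋁_{m ∈ M} Σ P_{>m} → P_Q` of Segev–Webb, Theorem 2.4. -/
def jmap {P : Type*} [PartialOrder P] (Q : Set P) : WT P Q → Option P
  | none => none
  | some (Sum.inl m) => some (m : P)
  | some (Sum.inr p) => some ((p.2 : P))

section OrderComplexRealization

variable {α β : Type*} [Fintype α] [Fintype β] {r : α → α → Prop} {r' : β → β → Prop}

theorem mem_Rl_fullCpx {w : α → ℝ} :
    w ∈ Rl (fullCpx α r) ↔ (∀ a, 0 ≤ w a) ∧ ∑ a, w a = 1 ∧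
      ∀ a b, w a ≠ 0 → w b ≠ 0 → a ≠ b → r a b ∨ r b a := by
  classical
  constructor
  · rintro ⟨h0, s, hs, hsupp, hsum⟩
    refine ⟨h0, ?_, fun a b ha hb => hs.2 a (hsupp a ha) b (hsupp b hb)⟩
    rw [← hsum]
    refine (Finset.sum_subset (Finset.subset_univ s) fun a _ ha => ?_).symm
    by_contra h
    exact ha (hsupp a h)
  · rintro ⟨h0, hsum, hcmp⟩
    refine ⟨h0, Finset.univ.filter (fun a => w a ≠ 0), ⟨Set.subset_univ _, ?_⟩, by simp, ?_⟩
    · intro a ha b hb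
      exact hcmp a b (Finset.mem_filter.1 ha).2 (Finset.mem_filter.1 hb).2
    · rw [Finset.sum_filter_ne_zero, hsum]

omit [Fintype α] in
@[fun_prop]
theorem continuous_Rl_apply (K : Set (Finset α)) (a : α) :
    Continuous fun x : ↥(Rl K) => (x : α → ℝ) a :=
  (continuous_apply a).comp continuous_subtype_val

/-- Two maps into an order complex whose values at each point lie in a common simplex are
homotopic along straight lines. -/
def lineHomotopy {X : Type*} [TopologicalSpace X] (f g : C(X, ↥(Rl (fullCpx α r))))
    (h : ∀ x a b, ((f x : α → ℝ) a ≠ 0 ∨ (g x : α → ℝ) a ≠ 0) →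
      ((f x : α → ℝ) b ≠ 0 ∨ (g x : α → ℝ) b ≠ 0) → a ≠ b → r a b ∨ r b a) :
    f.Homotopy g where
  toFun p := ⟨fun a => (1 - (p.1 : ℝ)) * (f p.2 : α → ℝ) a + (p.1 : ℝ) * (g p.2 : α → ℝ) a, by
    obtain ⟨hf0, hf1, -⟩ := mem_Rl_fullCpx.1 (f p.2).2
    obtain ⟨hg0, hg1, -⟩ := mem_Rl_fullCpx.1 (g p.2).2
    refine mem_Rl_fullCpx.2 ⟨fun a => ?_, ?_, fun a b ha hb => h p.2 a b ?_ ?_⟩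
    · have h1 := p.1.2.1
      have h2 := p.1.2.2
      exact add_nonneg (mul_nonneg (by linarith) (hf0 a)) (mul_nonneg h1 (hg0 a))
    · rw [Finset.sum_add_distrib, ← Finset.mul_sum, ← Finset.mul_sum, hf1, hg1]
      ring
    · by_contra! hc
      exact ha (by simp [hc.1, hc.2])
    · by_contra! hc
      exact hb (by simp [hc.1, hc.2])⟩
  continuous_toFun := by
    refine Continuous.subtype_mk (continuous_pi fun a => ?_) _
    have hf := (continuous_Rl_apply _ a).comp
      (f.continuous.comp (continuous_snd (X := unitInterval)))
    have hg := (continuous_Rl_apply _ a).comp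
      (g.continuous.comp (continuous_snd (X := unitInterval)))
    have ht : Continuous fun p : unitInterval × X => (p.1 : ℝ) :=
      continuous_subtype_val.comp continuous_fst
    exact ((continuous_const.sub ht).mul hf).add (ht.mul hg)
  map_zero_left x := by ext a; simp
  map_one_left x := by ext a; simp

theorem lineHomotopy_apply {X : Type*} [TopologicalSpace X]
    (f g : C(X, ↥(Rl (fullCpx α r)))) (h) (t : unitInterval) (x : X) (a : α) :
    (lineHomotopy f g h (t, x) : α → ℝ) a =
      (1 - (t : ℝ)) * (f x : α → ℝ) a + (t : ℝ) * (g x : α → ℝ) a := rfl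

/-- A simplicial map of order complexes in barycentric coordinates. -/
noncomputable def pushforward (f : α → β) (w : α → ℝ) (b : β) : ℝ :=
  open Classical in ∑ a, if f a = b then w a else 0

omit [Fintype β] in
theorem pushforward_eq_finsum (f : α → β) (w : α → ℝ) (b : β) :
    pushforward f w b = ∑ᶠ a ∈ {a | f a = b}, w a := by
  classical
  rw [finsum_mem_def, finsum_eq_sum_of_fintype]
  simp [pushforward, Set.indicator_apply]

omit [Fintype β] in
theorem exists_of_pushforward_ne_zero {f : α → β} {w : α → ℝ} {b : β}
    (h : pushforward f w b ≠ 0) : ∃ a, f a = b ∧ w a ≠ 0 := by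
  classical
  obtain ⟨a, -, ha⟩ := Finset.exists_ne_zero_of_sum_ne_zero h
  by_cases hab : f a = b
  · exact ⟨a, hab, by simpa [hab] using ha⟩
  · simp [hab] at ha

omit [Fintype β] in
theorem le_pushforward {f : α → β} {w : α → ℝ} (hw : ∀ a, 0 ≤ w a) (a : α) :
    w a ≤ pushforward f w (f a) := by
  classical
  have := Finset.single_le_sum (f := fun a' => if f a' = f a then w a' else 0)
    (fun i _ => by split_ifs <;> simp [hw]) (Finset.mem_univ a)
  simpa [pushforward] using this

theorem sum_pushforward (f : α → β) (w : α → ℝ) : ∑ b, pushforward f w b = ∑ a, w a := by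
  classical
  unfold pushforward
  rw [Finset.sum_comm]
  simp

omit [Fintype β] in
theorem pushforward_comp {f : α → β} {σ : α → α} {τ : β → β} (hσ : σ.Injective)
    (hτ : τ.Injective) (h : ∀ a, f (σ a) = τ (f a)) (w : α → ℝ) (b : β) :
    pushforward f (fun a => w (σ a)) b = pushforward f w (τ b) := by
  classical
  unfold pushforward
  rw [← (Finite.injective_iff_bijective.1 hσ).sum_comp (fun a => if f a = τ b then w a else 0)]
  simp [h, hτ.eq_iff]

/-- The map of realizations induced by a strictly monotone map. -/
noncomputable def realizationMap (f : α → β) (hf : ∀ ⦃a b⦄, r a b → r' (f a) (f b)) :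
    C(↥(Rl (fullCpx α r)), ↥(Rl (fullCpx β r'))) where
  toFun x := ⟨pushforward f x, by
    classical
    obtain ⟨h0, h1, hc⟩ := mem_Rl_fullCpx.1 x.2
    refine mem_Rl_fullCpx.2
      ⟨fun b => ?_, (sum_pushforward f x.1).trans h1, fun b b' hb hb' hn => ?_⟩
    · exact Finset.sum_nonneg fun a _ => by split_ifs <;> simp [h0]
    · obtain ⟨a, rfl, ha⟩ := exists_of_pushforward_ne_zero hb
      obtain ⟨a', rfl, ha'⟩ := exists_of_pushforward_ne_zero hb'
      exact (hc a a' ha ha' (fun h => hn (h ▸ rfl))).imp (@hf _ _) (@hf _ _)⟩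
  continuous_toFun := by
    classical
    refine Continuous.subtype_mk (continuous_pi fun b => ?_) _
    unfold pushforward
    refine continuous_finsetSum _ fun a _ => ?_
    split_ifs
    · exact continuous_Rl_apply _ a
    · exact continuous_const

/-- The total weight carried by the vertices outside `M`. -/
noncomputable def offMass (M : Set α) (w : α → ℝ) : ℝ :=
  open Classical in ∑ a, if a ∈ M then 0 else w a

theorem continuous_offMass (M : Set α) : Continuous (offMass M) := by
  classical
  unfold offMass
  refine continuous_finsetSum _ fun a _ => ?_
  split_ifs <;> fun_prop

theorem offMass_comp {M : Set α} {σ : α → α} (hσ : σ.Injective) (hM : ∀ a, σ a ∈ M ↔ a ∈ M)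
    (w : α → ℝ) : offMass M (fun a => w (σ a)) = offMass M w := by
  classical
  unfold offMass
  rw [← (Finite.injective_iff_bijective.1 hσ).sum_comp (fun a => if a ∈ M then 0 else w a)]
  simp [hM]

/-- A point of the order complex has at most one vertex in an antichain `M`. -/
theorem offMass_cases {M : Set α} (hM : ∀ a ∈ M, ∀ b ∈ M, ¬ r a b) {w : α → ℝ}
    (hw : w ∈ Rl (fullCpx α r)) :
    ((∀ m ∈ M, w m = 0) ∧ offMass M w = 1) ∨
      ∃ m ∈ M, 0 < w m ∧ offMass M w = 1 - w m ∧ ∀ m' ∈ M, m' ≠ m → w m' = 0 := by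
  classical
  obtain ⟨h0, h1, hc⟩ := mem_Rl_fullCpx.1 hw
  by_cases h : ∀ m ∈ M, w m = 0
  · refine Or.inl ⟨h, ?_⟩
    rw [← h1]
    refine Finset.sum_congr rfl fun a _ => ?_
    split_ifs with ha
    · exact (h a ha).symm
    · rfl
  · push Not at h
    obtain ⟨m, hm, hne⟩ := h
    have huniq : ∀ m' ∈ M, m' ≠ m → w m' = 0 := by
      intro m' hm' hn
      by_contra hw'
      exact (hc m' m hw' hne hn).elim (hM _ hm' _ hm) (hM _ hm _ hm')
    refine Or.inr ⟨m, hm, lt_of_le_of_ne (h0 m) hne.symm, ?_, huniq⟩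
    have : ∑ a, ((if a ∈ M then 0 else w a) + if a = m then w m else 0) = 1 := by
      rw [← h1]
      refine Finset.sum_congr rfl fun a _ => ?_
      by_cases ham : a = m
      · simp [ham, hm]
      · by_cases ha : a ∈ M
        · simp [ham, ha, huniq a ha ham]
        · simp [ham, ha]
    rw [Finset.sum_add_distrib] at this
    simp only [Finset.sum_ite_eq', Finset.mem_univ, if_true] at this
    unfold offMass
    linarith

theorem le_one_sub_offMass {M : Set α} (hM : ∀ a ∈ M, ∀ b ∈ M, ¬ r a b) {w : α → ℝ}
    (hw : w ∈ Rl (fullCpx α r)) {m : α} (hm : m ∈ M) : w m ≤ 1 - offMass M w := by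
  rcases offMass_cases hM hw with ⟨h, h1⟩ | ⟨m', -, hpos, h1, h⟩
  · rw [h m hm, h1, sub_self]
  · by_cases hmm : m = m'
    · rw [h1, hmm]; linarith
    · rw [h m hm hmm, h1]; linarith

/-- Pushes weight away from the antichain `M`, leaving no weight on `M` where there was at most
`1 / 2`. -/
noncomputable def shrink (M : Set α) (w : α → ℝ) (a : α) : ℝ :=
  open Classical in if a ∈ M then max (2 * w a - 1) 0 else w a / max (offMass M w) (1 / 2)

theorem shrink_comp {M : Set α} {σ : α → α} (hσ : σ.Injective) (hM : ∀ a, σ a ∈ M ↔ a ∈ M)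
    (w : α → ℝ) (a : α) : shrink M (fun a => w (σ a)) a = shrink M w (σ a) := by
  simp only [shrink, offMass_comp hσ hM]
  by_cases ha : a ∈ M <;> simp [ha, hM]

theorem half_lt_of_shrink_ne_zero {M : Set α} {w : α → ℝ} {a : α} (ha : a ∈ M)
    (h : shrink M w a ≠ 0) : 1 / 2 < w a := by
  by_contra! hle
  exact h (by simp only [shrink, if_pos ha]; exact max_eq_right (by linarith))

theorem ne_zero_of_shrink_ne_zero {M : Set α} {w : α → ℝ} {a : α}
    (h : shrink M w a ≠ 0) : w a ≠ 0 := by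
  by_cases ha : a ∈ M
  · have := half_lt_of_shrink_ne_zero ha h
    linarith
  · intro h0
    exact h (by simp [shrink, ha, h0])

theorem shrink_mem {M : Set α} (hM : ∀ a ∈ M, ∀ b ∈ M, ¬ r a b) {w : α → ℝ}
    (hw : w ∈ Rl (fullCpx α r)) : shrink M w ∈ Rl (fullCpx α r) := by
  classical
  obtain ⟨h0, h1, hc⟩ := mem_Rl_fullCpx.1 hw
  refine mem_Rl_fullCpx.2 ⟨fun a => ?_, ?_, fun a b ha hb =>
    hc a b (ne_zero_of_shrink_ne_zero ha) (ne_zero_of_shrink_ne_zero hb)⟩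
  · unfold shrink
    split_ifs
    · exact le_max_right _ _
    · exact div_nonneg (h0 a) (le_max_of_le_right (by norm_num))
  have hsplit : ∑ a, shrink M w a = (∑ a, if a ∈ M then max (2 * w a - 1) 0 else 0) +
      offMass M w / max (offMass M w) (1 / 2) := by
    conv_rhs => rw [offMass, Finset.sum_div, ← Finset.sum_add_distrib, ← offMass]
    refine Finset.sum_congr rfl fun a _ => ?_
    by_cases ha : a ∈ M <;> simp [shrink, ha]
  rw [hsplit]
  rcases offMass_cases hM hw with ⟨h, hC⟩ | ⟨m, hm, hpos, hC, h⟩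
  · rw [Finset.sum_eq_zero, hC]
    · norm_num
    · intro a _
      split_ifs with ha
      · simp [h a ha]
      · rfl
  · have hm1 : w m ≤ 1 := by
      rw [← h1]; exact Finset.single_le_sum (fun i _ => h0 i) (Finset.mem_univ m)
    rw [Finset.sum_eq_single m, hC, if_pos hm]
    · rcases le_total (w m) (1 / 2) with hle | hle
      · rw [max_eq_right (by linarith), max_eq_left (by linarith), div_self (by linarith)]
        norm_num
      · rw [max_eq_left (by linarith), max_eq_right (by linarith)]
        ring
    · intro a _ ha
      split_ifs with haM
      · simp [h a haM ha]
      · rfl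
    · simp

/-- `shrink` as a self-map of the realization. -/
noncomputable def shrinkMap {M : Set α} (hM : ∀ a ∈ M, ∀ b ∈ M, ¬ r a b) :
    C(↥(Rl (fullCpx α r)), ↥(Rl (fullCpx α r))) where
  toFun x := ⟨shrink M x, shrink_mem hM x.2⟩
  continuous_toFun := by
    refine Continuous.subtype_mk (continuous_pi fun a => ?_) _
    unfold shrink
    have hcont := (continuous_offMass M).comp
      (continuous_subtype_val (p := (· ∈ Rl (fullCpx α r))))
    split_ifs
    · exact ((continuous_const.mul (continuous_Rl_apply _ a)).sub continuous_const).max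
        continuous_const
    · refine Continuous.div (continuous_Rl_apply _ a) (hcont.max continuous_const) fun x => ?_
      exact ne_of_gt (lt_max_of_lt_right (by norm_num))

/-- Let `o` be a vertex lying below exactly the vertices off the antichain `M` and different from
`o`. A self-map of the order complex which adds no vertex other than `o` to the support of a point,
and adds `o` only where the weights on `M` are at most `1 / 2`, is homotopic to the identity,
naturally in the automorphisms commuting with it. -/
theorem exists_homotopy_id {M : Set α} {o : α} (hM : ∀ a ∈ M, ∀ b ∈ M, ¬ r a b)
    (ho : ∀ a ∉ M, a ≠ o → r o a)
    (e : C(↥(Rl (fullCpx α r)), ↥(Rl (fullCpx α r))))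
    (he : ∀ x a, a ≠ o → (e x : α → ℝ) a ≠ 0 → (x : α → ℝ) a ≠ 0)
    (heo : ∀ x, (e x : α → ℝ) o ≠ 0 → ∀ m ∈ M, (x : α → ℝ) m ≤ 1 / 2) :
    ∃ H : e.Homotopy (ContinuousMap.id _), ∀ σ : α → α, σ.Injective →
      (∀ a, σ a ∈ M ↔ a ∈ M) →
      (∀ x y : ↥(Rl (fullCpx α r)), ((y : α → ℝ) = fun a => (x : α → ℝ) (σ a)) →
        ((e y : α → ℝ) = fun a => (e x : α → ℝ) (σ a))) →
      ∀ t, ∀ x y : ↥(Rl (fullCpx α r)), ((y : α → ℝ) = fun a => (x : α → ℝ) (σ a)) →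
        ((H (t, y) : α → ℝ) = fun a => (H (t, x) : α → ℝ) (σ a)) := by
  have hcmp : ∀ x a, (e x : α → ℝ) a ≠ 0 ∨ (shrinkMap hM x : α → ℝ) a ≠ 0 →
      (x : α → ℝ) a ≠ 0 ∨ (a = o ∧ (e x : α → ℝ) o ≠ 0) := by
    rintro x a (ha | ha)
    · by_cases hao : a = o
      · exact Or.inr ⟨hao, hao ▸ ha⟩
      · exact Or.inl (he x a hao ha)
    · exact Or.inl (ne_zero_of_shrink_ne_zero ha)
  have hadd : ∀ x b, (e x : α → ℝ) o ≠ 0 →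
      (e x : α → ℝ) b ≠ 0 ∨ (shrinkMap hM x : α → ℝ) b ≠ 0 → o ≠ b → r o b ∨ r b o := by
    intro x b hox hb hne
    rcases hb with hb | hb
    · exact (mem_Rl_fullCpx.1 (e x).2).2.2 o b hox hb hne
    · refine Or.inl (ho b (fun hbM => ?_) hne.symm)
      have h1 := half_lt_of_shrink_ne_zero hbM hb
      have h2 := heo x hox b hbM
      linarith
  refine ⟨(lineHomotopy e (shrinkMap hM) ?_).trans
    (lineHomotopy (shrinkMap hM) (ContinuousMap.id _) ?_), ?_⟩
  · intro x a b ha hb hne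
    rcases hcmp x a ha with ha' | ⟨rfl, ha'⟩
    · rcases hcmp x b hb with hb' | ⟨rfl, hb'⟩
      · exact (mem_Rl_fullCpx.1 x.2).2.2 a b ha' hb' hne
      · exact (hadd x a hb' ha hne.symm).symm
    · exact hadd x b ha' hb hne
  · intro x a b ha hb hne
    exact (mem_Rl_fullCpx.1 x.2).2.2 a b (ha.elim ne_zero_of_shrink_ne_zero id)
      (hb.elim ne_zero_of_shrink_ne_zero id) hne
  · intro σ hσ hσM heσ t x y hxy
    have hs : ∀ a, (shrinkMap hM y : α → ℝ) a = (shrinkMap hM x : α → ℝ) (σ a) := by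
      intro a
      change shrink M y a = shrink M x (σ a)
      rw [hxy, shrink_comp hσ hσM]
    funext a
    simp only [ContinuousMap.Homotopy.trans_apply]
    split_ifs
    · rw [lineHomotopy_apply, lineHomotopy_apply, hs, heσ x y hxy]
    · rw [lineHomotopy_apply, lineHomotopy_apply, hs, ContinuousMap.id_apply,
        ContinuousMap.id_apply, hxy]

end OrderComplexRealization

section WedgeInverse

variable {P : Type*} [PartialOrder P] {Q : Set P}

theorem jmap_mono (hmin : ∀ p : P, p ∈ Q ∨ ∀ x : P, ¬ x < p) ⦃x y : WT P Q⦄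
    (h : wrelT P Q x y) : extRel (· < ·) Q (jmap Q x) (jmap Q y) := by
  rcases x with _ | m | ⟨m, x⟩ <;> rcases y with _ | m' | ⟨m', y⟩ <;> try exact h.elim
  · exact (hmin y).resolve_right fun hy => hy _ y.2
  · obtain rfl : m = m' := h
    exact y.2
  · obtain ⟨h1, h2⟩ := h
    dsimp only at h1 h2
    subst h1
    exact h2

/-- The elements of `M` inside `P_Q`. -/
def extMin (Q : Set P) : Set (Option P) := {b | ∃ p, p ∉ Q ∧ b = some p}

/-- The elements of `M` inside the wedge of suspensions. -/
def wedgeMin (Q : Set P) : Set (WT P Q) := {a | ∃ m, a = some (Sum.inl m)}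

omit [PartialOrder P] in
@[simp]
theorem some_mem_extMin {p : P} : some p ∈ extMin Q ↔ p ∉ Q := by
  simp [extMin]

omit [PartialOrder P] in
@[simp]
theorem none_notMem_extMin : none ∉ extMin Q := by
  simp [extMin]

theorem extMin_antichain (hmin : ∀ p : P, p ∈ Q ∨ ∀ x : P, ¬ x < p) :
    ∀ a ∈ extMin Q, ∀ b ∈ extMin Q, ¬ extRel (· < ·) Q a b := by
  rintro _ ⟨p, hp, rfl⟩ _ ⟨p', hp', rfl⟩ h
  exact (hmin p').resolve_left hp' p h

theorem wedgeMin_antichain : ∀ a ∈ wedgeMin Q, ∀ b ∈ wedgeMin Q, ¬ wrelT P Q a b := by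
  rintro _ ⟨m, rfl⟩ _ ⟨m', rfl⟩ h
  exact h

/-- Barycentric coordinates of a homotopy inverse of `j`: the half of the cone over `P_{>m}`
near `m` is stretched over the cone with apex `m` in the suspension, the half near `P_{>m}` over
the cone with apex `0̂`, and everything else is sent to `0̂`. -/
noncomputable def unfoldCone [Fintype P] (Q : Set P) (u : Option P → ℝ) : WT P Q → ℝ
  | none => max (2 * offMass (extMin Q) u - 1) 0
  | some (Sum.inl m) => max (2 * u (some (m : P)) - 1) 0
  | some (Sum.inr p) =>
      u (some (p.2 : P)) * (2 * u (some (p.1 : P)) /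
        max (1 - u (some (p.1 : P))) (u (some (p.1 : P))))

variable [Fintype P]

theorem lt_of_unfoldCone_none {u : Option P → ℝ} (h : unfoldCone Q u none ≠ 0) :
    1 / 2 < offMass (extMin Q) u := by
  by_contra! hle
  exact h (max_eq_right (by linarith))

theorem lt_of_unfoldCone_inl {u : Option P → ℝ} {m : ↥(Mset Q)}
    (h : unfoldCone Q u (some (Sum.inl m)) ≠ 0) : 1 / 2 < u (some (m : P)) := by
  by_contra! hle
  exact h (max_eq_right (by linarith))

theorem ne_zero_of_unfoldCone_inr {u : Option P → ℝ} {p : Σ m : ↥(Mset Q), PgtT m}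
    (h : unfoldCone Q u (some (Sum.inr p)) ≠ 0) :
    u (some (p.1 : P)) ≠ 0 ∧ u (some (p.2 : P)) ≠ 0 := by
  constructor <;> intro h0 <;> exact h (by simp [unfoldCone, h0])

theorem sum_unfoldCone [Fintype (WT P Q)] (hmin : ∀ p : P, p ∈ Q ∨ ∀ x : P, ¬ x < p)
    {u : Option P → ℝ} (hu : u ∈ Rl (fullCpx (Option P) (extRel (· < ·) Q))) :
    ∑ a, unfoldCone Q u a = 1 := by
  classical
  obtain ⟨h0, h1, hc⟩ := mem_Rl_fullCpx.1 hu
  have : ∀ m : ↥(Mset Q), Fintype (PgtT m) := fun m => Fintype.ofFinite _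
  have : Fintype ↥(Mset Q) := Fintype.ofFinite _
  have hsplit : ∑ a, unfoldCone Q u a = unfoldCone Q u none +
      ∑ m : ↥(Mset Q), (unfoldCone Q u (some (Sum.inl m)) +
        ∑ x : PgtT m, unfoldCone Q u (some (Sum.inr ⟨m, x⟩))) := by
    rw [Finset.sum_add_distrib, ← Fintype.sum_sigma', ← Fintype.sum_sum_type
      (fun a => unfoldCone Q u (some a)), ← Fintype.sum_option]
    convert rfl
  rw [hsplit]
  rcases offMass_cases (extMin_antichain hmin) hu with ⟨h, hC⟩ | ⟨_, ⟨p, hp, rfl⟩, hpos, hC, h⟩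
  · have hz : ∀ m : ↥(Mset Q), u (some (m : P)) = 0 := fun m => h _ (some_mem_extMin.2 m.2)
    simp [unfoldCone, hC, hz]
    norm_num
  · obtain ⟨m, rfl⟩ : ∃ m : ↥(Mset Q), (m : P) = p := ⟨⟨p, hp⟩, rfl⟩
    have hz : ∀ m' : ↥(Mset Q), m' ≠ m → u (some (m' : P)) = 0 := fun m' hne =>
      h _ (some_mem_extMin.2 m'.2) fun h' => hne (Subtype.ext (Option.some_injective _ h'))
    have habove : ∑ x : PgtT m, u (some (x : P)) = 1 - u (some (m : P)) := by
      rw [← hC, offMass, Fintype.sum_option, if_neg none_notMem_extMin]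
      have hnone : u none = 0 := by
        by_contra hn
        exact (hc none (some m) hn hpos.ne' (by simp)).elim m.2 id
      rw [hnone, zero_add, ← Finset.sum_subtype (Finset.univ.filter ((m : P) < ·)) (by simp)
        (fun x => u (some x)), Finset.sum_filter]
      refine Finset.sum_congr rfl fun x _ => ?_
      by_cases hx : x ∈ Q
      · rw [if_neg (fun h' => some_mem_extMin.1 h' hx)]
        refine ite_eq_left_iff.2 fun hlt => ?_
        by_contra hux
        refine (hc (some (m : P)) (some x) hpos.ne' (Ne.symm hux) fun h' => ?_).elim hlt
          ((hmin m).resolve_left m.2 x)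
        exact m.2 (Option.some_injective _ h' ▸ hx)
      · rw [if_pos (some_mem_extMin.2 hx), if_neg ((hmin x).resolve_left hx m)]
    rw [Finset.sum_eq_single m]
    · simp only [unfoldCone]
      rw [← Finset.sum_mul, habove, hC]
      rcases le_total (u (some (m : P))) (1 / 2) with hle | hle
      · rw [max_eq_left (by linarith), max_eq_right (by linarith), max_eq_left (by linarith),
          mul_div_cancel₀ _ (by linarith)]
        ring
      · rw [max_eq_right (by linarith), max_eq_left (by linarith), max_eq_right (by linarith),
          mul_div_assoc, div_self hpos.ne']
        ring
    · intro m' _ hne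
      simp [unfoldCone, hz m' hne]
    · simp

theorem unfoldCone_mem [Fintype (WT P Q)] (hmin : ∀ p : P, p ∈ Q ∨ ∀ x : P, ¬ x < p)
    {u : Option P → ℝ} (hu : u ∈ Rl (fullCpx (Option P) (extRel (· < ·) Q))) :
    unfoldCone Q u ∈ Rl (fullCpx (WT P Q) (wrelT P Q)) := by
  obtain ⟨h0, h1, hc⟩ := mem_Rl_fullCpx.1 hu
  have heq : ∀ m m' : ↥(Mset Q), u (some (m : P)) ≠ 0 → u (some (m' : P)) ≠ 0 → m = m' := by
    intro m m' hm hm'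
    by_contra hne
    exact (hc _ _ hm hm' fun h => hne (Subtype.ext (Option.some_injective _ h))).elim
      ((hmin m').resolve_left m'.2 _) ((hmin m).resolve_left m.2 _)
  have hbase : ∀ m : ↥(Mset Q), unfoldCone Q u none ≠ 0 →
      unfoldCone Q u (some (Sum.inl m)) ≠ 0 → False := by
    intro m hn hm
    have h2 := lt_of_unfoldCone_none hn
    have h3 := lt_of_unfoldCone_inl hm
    have h4 := le_one_sub_offMass (extMin_antichain hmin) hu (some_mem_extMin.2 m.2)
    linarith
  refine mem_Rl_fullCpx.2 ⟨?_, sum_unfoldCone hmin hu, ?_⟩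
  · rintro (_ | m | p)
    · exact le_max_right _ _
    · exact le_max_right _ _
    · exact mul_nonneg (h0 _)
        (div_nonneg (mul_nonneg zero_le_two (h0 _)) (le_max_of_le_right (h0 _)))
  · rintro (_ | m | ⟨m, x⟩) (_ | m' | ⟨m', y⟩) ha hb hne
    · exact absurd rfl hne
    · exact (hbase m' ha hb).elim
    · exact Or.inl trivial
    · exact (hbase m hb ha).elim
    · have h2 := lt_of_unfoldCone_inl ha
      have h3 := lt_of_unfoldCone_inl hb
      exact absurd (by rw [heq m m' (by linarith) (by linarith)]) hne
    · have h2 := lt_of_unfoldCone_inl ha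
      exact Or.inl (heq m m' (by linarith) (ne_zero_of_unfoldCone_inr hb).1)
    · exact Or.inr trivial
    · have h2 := lt_of_unfoldCone_inl hb
      exact Or.inr (heq m' m (by linarith) (ne_zero_of_unfoldCone_inr ha).1)
    · obtain ⟨hm, hx⟩ := ne_zero_of_unfoldCone_inr ha
      obtain ⟨hm', hy⟩ := ne_zero_of_unfoldCone_inr hb
      obtain rfl := heq m m' hm hm'
      have hxy : (x : P) ≠ y := fun h => hne (by rw [Subtype.ext h])
      exact (hc _ _ hx hy fun h => hxy (Option.some_injective _ h)).imp
        (fun h => ⟨rfl, h⟩) (fun h => ⟨rfl, h⟩)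

/-- A homotopy inverse of the map induced by `j`. -/
noncomputable def unfoldConeMap [Fintype (WT P Q)] (hmin : ∀ p : P, p ∈ Q ∨ ∀ x : P, ¬ x < p) :
    C(↥(Rl (fullCpx (Option P) (extRel (· < ·) Q))), ↥(Rl (fullCpx (WT P Q) (wrelT P Q)))) where
  toFun u := ⟨unfoldCone Q u, unfoldCone_mem hmin u.2⟩
  continuous_toFun := by
    refine Continuous.subtype_mk (continuous_pi ?_) _
    have hcoord := continuous_Rl_apply (fullCpx (Option P) (extRel (· < ·) Q))
    rintro (_ | m | p)
    · exact ((continuous_const.mul ((continuous_offMass _).comp continuous_subtype_val)).sub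
        continuous_const).max continuous_const
    · exact ((continuous_const.mul (hcoord _)).sub continuous_const).max continuous_const
    · refine (hcoord _).mul ((continuous_const.mul (hcoord _)).div
        ((continuous_const.sub (hcoord _)).max (hcoord _)) fun u => ?_)
      intro h
      have h2 := le_max_left (1 - (u : Option P → ℝ) (some (p.1 : P)))
        ((u : Option P → ℝ) (some (p.1 : P)))
      have h3 := le_max_right (1 - (u : Option P → ℝ) (some (p.1 : P)))
        ((u : Option P → ℝ) (some (p.1 : P)))
      linarith

end WedgeInverse

section Equivariance

variable {P : Type*} [PartialOrder P] {G : Type*} [Group G] [MulAction G P] {Q : Set P}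

theorem jmap_wVer (hsmul : ∀ (g : G) ⦃x y : P⦄, x < y → g • x < g • y)
    (hQG : ∀ (g : G) (q : P), q ∈ Q → g • q ∈ Q) (g : G) (x : WT P Q) :
    jmap Q (wVer hsmul hQG g x) = Option.map ((g • ·) : P → P) (jmap Q x) := by
  rcases x with _ | m | p <;> rfl

theorem wVer_injective (hsmul : ∀ (g : G) ⦃x y : P⦄, x < y → g • x < g • y)
    (hQG : ∀ (g : G) (q : P), q ∈ Q → g • q ∈ Q) (g : G) :
    Function.Injective (wVer hsmul hQG g) := by
  have hM : Function.Injective (gMe hQG g) := fun m m' h =>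
    Subtype.ext (MulAction.injective g (congrArg Subtype.val h))
  refine Option.map_injective (Sum.map_injective.2 ⟨hM, ?_⟩)
  rintro ⟨m, x⟩ ⟨m', y⟩ h
  obtain rfl : m = m' := hM (congrArg Sigma.fst h)
  have hxy := congrArg Subtype.val (eq_of_heq (Sigma.mk.inj h).2)
  rw [show x = y from Subtype.ext (MulAction.injective g hxy)]

theorem wVer_mem_wedgeMin (hsmul : ∀ (g : G) ⦃x y : P⦄, x < y → g • x < g • y)
    (hQG : ∀ (g : G) (q : P), q ∈ Q → g • q ∈ Q) (g : G) (a : WT P Q) :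
    wVer hsmul hQG g a ∈ wedgeMin Q ↔ a ∈ wedgeMin Q := by
  rcases a with _ | m | p <;> simp [wVer, wedgeMin]

omit [PartialOrder P] in
theorem map_smul_mem_extMin (hQG : ∀ (g : G) (q : P), q ∈ Q → g • q ∈ Q) (g : G) (b : Option P) :
    Option.map ((g • ·) : P → P) b ∈ extMin Q ↔ b ∈ extMin Q := by
  rcases b with _ | p
  · rfl
  · simp only [Option.map_some, some_mem_extMin, not_iff_not]
    exact ⟨fun h => by simpa using hQG g⁻¹ _ h, hQG g p⟩

theorem unfoldCone_smul [Fintype P] (hsmul : ∀ (g : G) ⦃x y : P⦄, x < y → g • x < g • y)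
    (hQG : ∀ (g : G) (q : P), q ∈ Q → g • q ∈ Q) (g : G) (u : Option P → ℝ) (a : WT P Q) :
    unfoldCone Q (fun b => u (Option.map ((g • ·) : P → P) b)) a =
      unfoldCone Q u (wVer hsmul hQG g a) := by
  rcases a with _ | m | p
  · simp only [unfoldCone, wVer, Option.map_none,
      offMass_comp (Option.map_injective (MulAction.injective g)) (map_smul_mem_extMin hQG g)]
  · rfl
  · rfl

end Equivariance

/-- Segev–Webb, Theorem 2.4(i).  If the finite `G`-poset `P` is an
extension of the `G`-stable subposet `Q` by minimal elements and `M = P \ Q`, then the map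
`j : ⋁_{m ∈ M} Σ P_{>m} → P_Q` (`j(x, m) = x`, `j(m) = m`, `j(0̂) = 0̂_Q`) is a
`G`-homotopy equivalence: it is an order-preserving `G`-map and the induced (affine) map on
geometric realizations of order complexes is a homotopy equivalence through `G`-equivariant
maps and `G`-equivariant homotopies. -/
theorem statement9 {P : Type*} [PartialOrder P] [Finite P] [DecidableEq P]
    {G : Type*} [Group G] [MulAction G P]
    (hsmul : ∀ (g : G) ⦃x y : P⦄, x < y → g • x < g • y)
    (Q : Set P)
    (hQupper : ∀ q ∈ Q, ∀ p : P, q ≤ p → p ∈ Q)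
    (hQext : ∀ p : P, ∃ q ∈ Q, p ≤ q)
    (hQG : ∀ (g : G) (q : P), q ∈ Q → g • q ∈ Q)
    (hmin : ∀ p : P, p ∈ Q ∨ ∀ x : P, ¬ x < p) :
    -- j is a map of G-posets
    (∀ ⦃x y : WT P Q⦄, wrelT P Q x y → extRel (· < ·) Q (jmap Q x) (jmap Q y)) ∧
    (∀ (g : G) (x : WT P Q),
      jmap Q (wVer hsmul hQG g x) = Option.map ((g • ·) : P → P) (jmap Q x)) ∧
    -- and it induces a G-equivariant homotopy equivalence of order complexes
    ∃ (F : C(↥(Rl (fullCpx (WT P Q) (wrelT P Q))),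
          ↥(Rl (fullCpx (Option P) (extRel (· < ·) Q)))))
      (F' : C(↥(Rl (fullCpx (Option P) (extRel (· < ·) Q))),
          ↥(Rl (fullCpx (WT P Q) (wrelT P Q)))))
      (H1 : (F'.comp F).Homotopy (ContinuousMap.id _))
      (H2 : (F.comp F').Homotopy (ContinuousMap.id _)),
      -- F is the affine extension of j
      (∀ (x : ↥(Rl (fullCpx (WT P Q) (wrelT P Q)))) (b : Option P),
        (F x : Option P → ℝ) b = ∑ᶠ a ∈ {a : WT P Q | jmap Q a = b}, (x : WT P Q → ℝ) a) ∧
      -- F is G-equivariant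
      (∀ (g : G) (x y : ↥(Rl (fullCpx (WT P Q) (wrelT P Q)))),
        ((y : WT P Q → ℝ) = fun a => (x : WT P Q → ℝ) (wVer hsmul hQG g⁻¹ a)) →
        ((F y : Option P → ℝ) =
          fun b => (F x : Option P → ℝ) (Option.map ((g⁻¹ • ·) : P → P) b))) ∧
      -- the homotopy inverse is G-equivariant
      (∀ (g : G) (u v : ↥(Rl (fullCpx (Option P) (extRel (· < ·) Q)))),
        ((v : Option P → ℝ) =
          fun b => (u : Option P → ℝ) (Option.map ((g⁻¹ • ·) : P → P) b)) →
        ((F' v : WT P Q → ℝ) = fun a => (F' u : WT P Q → ℝ) (wVer hsmul hQG g⁻¹ a))) ∧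
      -- both homotopies are G-equivariant
      (∀ (g : G) (t : unitInterval) (x y : ↥(Rl (fullCpx (WT P Q) (wrelT P Q)))),
        ((y : WT P Q → ℝ) = fun a => (x : WT P Q → ℝ) (wVer hsmul hQG g⁻¹ a)) →
        ((H1 (t, y) : WT P Q → ℝ) =
          fun a => (H1 (t, x) : WT P Q → ℝ) (wVer hsmul hQG g⁻¹ a))) ∧
      (∀ (g : G) (t : unitInterval) (u v : ↥(Rl (fullCpx (Option P) (extRel (· < ·) Q)))),
        ((v : Option P → ℝ) =
          fun b => (u : Option P → ℝ) (Option.map ((g⁻¹ • ·) : P → P) b)) →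
        ((H2 (t, v) : Option P → ℝ) =
          fun b => (H2 (t, u) : Option P → ℝ) (Option.map ((g⁻¹ • ·) : P → P) b))) := by
  classical
  have := Fintype.ofFinite P
  have := Fintype.ofFinite (WT P Q)
  let F := realizationMap (jmap Q) (jmap_mono hmin)
  let F' := unfoldConeMap hmin
  have hFeq : ∀ (g : G) (x y : ↥(Rl (fullCpx (WT P Q) (wrelT P Q)))),
      ((y : WT P Q → ℝ) = fun a => (x : WT P Q → ℝ) (wVer hsmul hQG g⁻¹ a)) →
      ((F y : Option P → ℝ) =
        fun b => (F x : Option P → ℝ) (Option.map ((g⁻¹ • ·) : P → P) b)) := by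
    intro g x y hxy
    funext b
    change pushforward _ _ _ = pushforward _ _ _
    rw [hxy, pushforward_comp (wVer_injective hsmul hQG g⁻¹)
      (Option.map_injective (MulAction.injective g⁻¹)) (jmap_wVer hsmul hQG g⁻¹)]
  have hF'eq : ∀ (g : G) (u v : ↥(Rl (fullCpx (Option P) (extRel (· < ·) Q)))),
      ((v : Option P → ℝ) =
        fun b => (u : Option P → ℝ) (Option.map ((g⁻¹ • ·) : P → P) b)) →
      ((F' v : WT P Q → ℝ) = fun a => (F' u : WT P Q → ℝ) (wVer hsmul hQG g⁻¹ a)) := by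
    intro g u v huv
    funext a
    change unfoldCone _ _ _ = unfoldCone _ _ _
    rw [huv, unfoldCone_smul hsmul hQG]
  have hFsupp : ∀ x b, (F x : Option P → ℝ) b ≠ 0 →
      ∃ a, jmap Q a = b ∧ (x : WT P Q → ℝ) a ≠ 0 := fun x b =>
    exists_of_pushforward_ne_zero
  have hFmin : ∀ x (m : ↥(Mset Q)), (F x : Option P → ℝ) (some (m : P)) ≠ 0 →
      (x : WT P Q → ℝ) (some (Sum.inl m)) ≠ 0 := by
    intro x m hm
    obtain ⟨_ | m' | ⟨m', y⟩, ha, hx⟩ := hFsupp x _ hm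
    · simp [jmap] at ha
    · rwa [← Subtype.ext (Option.some_injective _ ha)]
    · refine ((hmin m).resolve_left m.2 (m' : P) ?_).elim
      rw [← Option.some_injective _ ha]
      exact y.2
  obtain ⟨H1, hH1⟩ := exists_homotopy_id (o := none) wedgeMin_antichain
    (r := wrelT P Q) (by
      rintro (_ | m | p) ha hne
      · exact absurd rfl hne
      · exact absurd ⟨m, rfl⟩ ha
      · trivial) (F'.comp F) (by
      rintro x (_ | m | ⟨m, y⟩) hne ha
      · exact absurd rfl hne
      · have h := lt_of_unfoldCone_inl ha
        exact hFmin x m (by linarith)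
      · obtain ⟨hm, hy⟩ := ne_zero_of_unfoldCone_inr ha
        have hxm := hFmin x m hm
        obtain ⟨_ | m' | ⟨m', y'⟩, hj, hx⟩ := hFsupp x _ hy
        · simp [jmap] at hj
        · have h2 : (m : P) < m' := by
            have h3 : (m' : P) = y := Option.some_injective _ hj
            rw [h3]; exact y.2
          exact ((hmin m').resolve_left m'.2 _ h2).elim
        · obtain rfl : m = m' :=
            ((mem_Rl_fullCpx.1 x.2).2.2 _ _ hxm hx (by simp)).elim id False.elim
          rwa [← show y' = y from Subtype.ext (Option.some_injective _ hj)]) (by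
      rintro x hx _ ⟨m, rfl⟩
      have h2 := lt_of_unfoldCone_none hx
      have h3 := le_one_sub_offMass (extMin_antichain hmin) (F x).2 (some_mem_extMin.2 m.2)
      have h4 := le_pushforward (f := jmap Q) x.2.1 (some (Sum.inl m))
      change pushforward (jmap Q) x (some (m : P)) ≤ _ at h3
      change _ ≤ pushforward (jmap Q) x (some (m : P)) at h4
      linarith)
  obtain ⟨H2, hH2⟩ := exists_homotopy_id (o := none) (extMin_antichain hmin)
    (by
      rintro (_ | p) ha hne
      · exact absurd rfl hne
      · exact not_not.1 fun hp => ha (some_mem_extMin.2 hp)) (F.comp F') (by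
      rintro u (_ | p) hne hb
      · exact absurd rfl hne
      · obtain ⟨_ | m | ⟨m, y⟩, hj, ha⟩ := hFsupp (F' u) _ hb
        · simp [jmap] at hj
        · have h := lt_of_unfoldCone_inl ha
          rw [← hj]
          change (u : Option P → ℝ) (some (m : P)) ≠ 0
          linarith
        · rw [← hj]
          exact (ne_zero_of_unfoldCone_inr ha).2) (by
      rintro u hu b hb
      obtain ⟨_ | m | ⟨m, y⟩, hj, ha⟩ := hFsupp (F' u) _ hu
      · have h2 := lt_of_unfoldCone_none ha
        have h3 := le_one_sub_offMass (extMin_antichain hmin) u.2 hb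
        linarith
      · simp [jmap] at hj
      · simp [jmap] at hj)
  exact ⟨jmap_mono hmin, jmap_wVer hsmul hQG, F, F', H1, H2,
    fun x b => pushforward_eq_finsum _ _ _, hFeq, hF'eq,
    fun g => hH1 _ (wVer_injective hsmul hQG g⁻¹) (wVer_mem_wedgeMin hsmul hQG g⁻¹)
      fun x y h => hF'eq g _ _ (hFeq g x y h),
    fun g => hH2 _ (Option.map_injective (MulAction.injective g⁻¹))
      (map_smul_mem_extMin hQG g⁻¹) fun u v h => hFeq g _ _ (hF'eq g u v h)⟩
end
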